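/- Let T be a k-algebra of finite transcendence degree over k which is an integral domain, M a maximal ideal of T with ht(M) ≤ 2, K = T/M, φ : T → K the canonical surjection, D a subring of K, and A := φ^{-1}(D). If T and D are AF-domains, then A is a GAF-domain; that is, for every k-algebra B of finite transcendence degree over k and every prime ideal P of A⊗_kB with p = P∩A and q = P∩B, ht(P) = ht(p⊗_kB + A⊗_kq) + ht(P/(p⊗_kB + A⊗_kq)). -/

import Mathlib

open TensorProduct

noncomputable section

/-- Transcendence degree of the `R`-algebra `A` as a cardinal: the supremum of the
cardinalities of algebraically independent subsets of `A` over `R`. -/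
def trdegC (R A : Type*) [CommRing R] [CommRing A] [Algebra R A] : Cardinal :=
  ⨆ s : { s : Set A // AlgebraicIndependent R ((↑) : s → A) }, Cardinal.mk s.1

/-- Transcendence degree of the `R`-algebra `A`, as an extended natural number. -/
def eTrdeg (R A : Type*) [CommRing R] [CommRing A] [Algebra R A] : ℕ∞ :=
  Cardinal.toENat (trdegC R A)

/-- Height of an ideal: the infimum of the heights of the prime ideals containing it,
the height of a prime being taken in the prime spectrum ordered by inclusion. -/
def idealHt {R : Type*} [CommRing R] (I : Ideal R) : ℕ∞ :=
  ⨅ P : { P : PrimeSpectrum R // I ≤ P.asIdeal }, Order.height P.1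

/-- The extension `p[n]` of an ideal `p` of `A` to the polynomial ring
`A[X_1, ..., X_n]`. -/
def polyExt {A : Type*} [CommRing A] (n : ℕ) (p : Ideal A) : Ideal (MvPolynomial (Fin n) A) :=
  p.map (MvPolynomial.C : A →+* MvPolynomial (Fin n) A)

/-- An AF-domain over `k`: a `k`-algebra which is an integral domain such that
`ht p + t.d.(A/p) = t.d.(A)` for every prime ideal `p` of `A`. -/
def IsAFDomain (k A : Type*) [Field k] [CommRing A] [IsDomain A] [Algebra k A] : Prop :=
  ∀ p : Ideal A, p.IsPrime → idealHt p + eTrdeg k (A ⧸ p) = eTrdeg k A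

/-- A GAF-domain over `k`: for every `k`-algebra `B` (of finite transcendence degree)
and every prime `P` of `A ⊗[k] B` with `p = P ∩ A`, `q = P ∩ B`,
`ht P = ht (p⊗B + A⊗q) + ht (P/(p⊗B + A⊗q))`. -/
def IsGAFDomain (k A : Type) [Field k] [CommRing A] [IsDomain A] [Algebra k A] : Prop :=
  ∀ (B : Type) (_ : CommRing B) (_ : Algebra k B), eTrdeg k B ≠ ⊤ →
    ∀ P : Ideal (A ⊗[k] B), P.IsPrime →
      ∀ p : Ideal A,
        p = P.comap (Algebra.TensorProduct.includeLeft : A →ₐ[k] A ⊗[k] B).toRingHom →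
      ∀ q : Ideal B,
        q = P.comap (Algebra.TensorProduct.includeRight : B →ₐ[k] A ⊗[k] B).toRingHom →
      idealHt P =
        idealHt (p.map (Algebra.TensorProduct.includeLeft : A →ₐ[k] A ⊗[k] B).toRingHom ⊔
                 q.map (Algebra.TensorProduct.includeRight : B →ₐ[k] A ⊗[k] B).toRingHom) +
        idealHt (P.map (Ideal.Quotient.mk
          (p.map (Algebra.TensorProduct.includeLeft : A →ₐ[k] A ⊗[k] B).toRingHom ⊔
           q.map (Algebra.TensorProduct.includeRight : B →ₐ[k] A ⊗[k] B).toRingHom)))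

universe u

section TranscendenceDegree

variable {k : Type u} [Field k]

theorem eTrdeg_eq_toENat_trdeg (R A : Type u) [CommRing R] [CommRing A] [Algebra R A] :
    eTrdeg R A = Cardinal.toENat (Algebra.trdeg R A) := rfl

theorem eTrdeg_le_of_injective {R A B : Type u} [CommRing R] [Nontrivial R] [CommRing A]
    [CommRing B] [Algebra R A] [Algebra R B] (f : A →ₐ[R] B) (hf : Function.Injective f) :
    eTrdeg R A ≤ eTrdeg R B :=
  Cardinal.toENat.monotone' (trdeg_le_of_injective f hf)

theorem eTrdeg_le_of_surjective {R A B : Type u} [CommRing R] [Nontrivial R] [CommRing A]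
    [CommRing B] [Algebra R A] [Algebra R B] (f : A →ₐ[R] B) (hf : Function.Surjective f) :
    eTrdeg R B ≤ eTrdeg R A :=
  Cardinal.toENat.monotone' (trdeg_le_of_surjective f hf)

theorem eTrdeg_congr {R A B : Type u} [CommRing R] [Nontrivial R] [CommRing A]
    [CommRing B] [Algebra R A] [Algebra R B] (e : A ≃ₐ[R] B) : eTrdeg R A = eTrdeg R B :=
  (eTrdeg_le_of_injective e.toAlgHom e.injective).antisymm
    (eTrdeg_le_of_surjective e.toAlgHom e.surjective)

theorem eTrdeg_add_eq (R S A : Type u) [CommRing R] [CommRing S] [CommRing A] [Nontrivial R]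
    [NoZeroDivisors A] [Algebra R S] [Algebra S A] [Algebra R A] [IsScalarTower R S A]
    [FaithfulSMul R S] [FaithfulSMul S A] : eTrdeg R S + eTrdeg S A = eTrdeg R A := by
  simp only [eTrdeg_eq_toENat_trdeg]
  rw [← trdeg_add_eq R S (A := A), map_add]

theorem eTrdeg_le_encard {R A : Type u} [CommRing R] [CommRing A] [NoZeroDivisors A] [Algebra R A]
    (s : Set A) (h : Algebra.IsAlgebraic (Algebra.adjoin R s) A) : eTrdeg R A ≤ s.encard :=
  Cardinal.toENat.monotone' (Algebra.IsAlgebraic.trdeg_le_cardinalMk R s)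

theorem encard_eq_eTrdeg {R A : Type u} [CommRing R] [Nontrivial R] [CommRing A] [NoZeroDivisors A]
    [Algebra R A] {s : Set A} (h : IsTranscendenceBasis R ((↑) : s → A)) :
    s.encard = eTrdeg R A := by
  rw [eTrdeg_eq_toENat_trdeg, ← h.cardinalMk_eq_trdeg]; rfl

theorem eTrdeg_polynomial (D : Type u) [CommRing D] [IsDomain D] [Algebra k D] :
    eTrdeg k (Polynomial D) = eTrdeg k D + 1 := by
  rw [← eTrdeg_add_eq k D (Polynomial D)]
  congr 1
  rw [eTrdeg_eq_toENat_trdeg, Polynomial.trdeg_of_isDomain]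
  simp

/-- A nonzero ideal of a domain of finite transcendence degree contains an element
which is algebraic over any transcendence basis coming from the quotient, so passing to the
quotient lowers the transcendence degree. -/
theorem eTrdeg_add_one_le_of_not_injective {A B : Type u} [CommRing A] [IsDomain A] [CommRing B]
    [IsDomain B] [Algebra k A] [Algebra k B] (f : A →ₐ[k] B) (hf : Function.Surjective f)
    (hn : ¬ Function.Injective f) (hfin : eTrdeg k A ≠ ⊤) : eTrdeg k B + 1 ≤ eTrdeg k A := by
  refine (ENat.add_one_le_iff ?_).2 (lt_of_le_of_ne (eTrdeg_le_of_surjective f hf) ?_)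
  · exact ne_top_of_le_ne_top hfin (eTrdeg_le_of_surjective f hf)
  intro heq
  apply hn
  obtain ⟨s, hs⟩ := exists_isTranscendenceBasis k B
  have hx : AlgebraicIndependent k (f ∘ fun b : s => Function.surjInv hf b.1) := by
    have he : (f ∘ fun b : s => Function.surjInv hf b.1) = ((↑) : s → B) :=
      funext fun b => Function.surjInv_eq hf b.1
    rw [he]
    exact hs.1
  have hfin' : Algebra.trdeg k A < Cardinal.aleph0 := by
    rw [eTrdeg_eq_toENat_trdeg] at hfin
    simpa using hfin
  have hle : Algebra.trdeg k A ≤ Cardinal.mk s := by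
    rw [hs.cardinalMk_eq_trdeg]
    rw [eTrdeg_eq_toENat_trdeg, eTrdeg_eq_toENat_trdeg] at heq
    have hB : Algebra.trdeg k B < Cardinal.aleph0 :=
      (trdeg_le_of_surjective f hf).trans_lt hfin'
    exact ((Cardinal.toENat_eq_iff_of_le_aleph0 hB.le hfin'.le).1 heq).ge
  have hb : IsTranscendenceBasis k (fun b : s => Function.surjInv hf b.1) :=
    (AlgebraicIndependent.of_comp f hx).isTranscendenceBasis_of_trdeg_le hfin' hle
  have halg := hb.isAlgebraic
  refine (injective_iff_map_eq_zero f).2 fun a ha => by_contra fun ha0 => ?_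
  obtain ⟨⟨r, hr⟩, hr0, c, hc⟩ :=
    (halg.isAlgebraic a).exists_nonzero_dvd (mem_nonZeroDivisors_of_ne_zero ha0)
  rw [Algebra.adjoin_range_eq_range_aeval] at hr
  obtain ⟨P, hP⟩ := hr
  have h0 : f r = 0 := by
    have hrc : r = a * c := hc
    rw [hrc, map_mul, ha, zero_mul]
  have hP0 : P = 0 := by
    refine (injective_iff_map_eq_zero _).1 hx P ?_
    rw [← h0, ← hP]
    exact (MvPolynomial.comp_aeval_apply (fun b : s => Function.surjInv hf b.1) f P).symm
  exact hr0 (Subtype.ext (by change r = 0; rw [← hP, hP0]; simp))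

end TranscendenceDegree

section Spectrum

variable {k : Type u} [Field k]

theorem height_le_of_forall_lt {α : Type*} [Preorder α] {x : α} {m : ℕ∞}
    (h : ∀ y < x, Order.height y + 1 ≤ m) : Order.height x ≤ m := by
  induction m using ENat.recTopCoe with
  | top => exact le_top
  | coe n =>
    exact (Order.height_le_coe_iff).2 fun y hy =>
      (ENat.add_one_le_iff (fun ht => by simpa [ht] using h y hy)).1 (h y hy)

/-- The transcendence degree of the residue ring at a point of the spectrum. -/
def trdegAt (k : Type u) [Field k] {S : Type u} [CommRing S] [Algebra k S]
    (x : PrimeSpectrum S) : ℕ∞ :=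
  eTrdeg k (S ⧸ x.asIdeal)

/-- The sum of the height of a prime and of the transcendence degree of its residue ring. -/
def heightAddTrdeg (k : Type u) [Field k] {S : Type u} [CommRing S] [Algebra k S]
    (x : PrimeSpectrum S) : ℕ∞ :=
  Order.height x + trdegAt k x

/-- The transcendence degrees of the residue rings are uniformly bounded. -/
def BoundedTrdeg (k : Type u) [Field k] (S : Type u) [CommRing S] [Algebra k S] : Prop :=
  ∃ N : ℕ, ∀ x : PrimeSpectrum S, trdegAt k x ≤ N

/-- `heightAddTrdeg` is constant on the fibres of the map of spectra induced by `f`. -/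
def FibreConst (k : Type u) [Field k] {B S : Type u} [CommRing B] [CommRing S]
    [Algebra k B] [Algebra k S] (f : B →ₐ[k] S) : Prop :=
  ∀ x y : PrimeSpectrum S, PrimeSpectrum.comap f.toRingHom x = PrimeSpectrum.comap f.toRingHom y →
    heightAddTrdeg k x = heightAddTrdeg k y

variable {B S : Type u} [CommRing B] [CommRing S] [Algebra k B] [Algebra k S]

theorem BoundedTrdeg.ne_top (h : BoundedTrdeg k S) (x : PrimeSpectrum S) : trdegAt k x ≠ ⊤ :=
  let ⟨N, hN⟩ := h
  ne_top_of_le_ne_top (ENat.natCast_ne_top N) (hN x)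

theorem trdegAt_anti {x y : PrimeSpectrum S} (h : x ≤ y) : trdegAt k y ≤ trdegAt k x :=
  have h_le : x.asIdeal ≤ y.asIdeal := h
  eTrdeg_le_of_surjective (Ideal.Quotient.factorₐ k h_le)
    (Ideal.Quotient.factor_surjective h_le)

theorem trdegAt_add_one_le {x y : PrimeSpectrum S} (h : x < y) (hx : trdegAt k x ≠ ⊤) :
    trdegAt k y + 1 ≤ trdegAt k x := by
  have h_le : x.asIdeal ≤ y.asIdeal := h.le
  refine eTrdeg_add_one_le_of_not_injective (Ideal.Quotient.factorₐ k h_le)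
    (Ideal.Quotient.factor_surjective h_le) (fun hinj => h.not_ge fun a ha => ?_) hx
  refine Ideal.Quotient.eq_zero_iff_mem.1 (hinj ?_)
  rw [map_zero]
  exact Ideal.Quotient.eq_zero_iff_mem.2 ha

theorem trdegAt_comap_le (f : B →ₐ[k] S) (x : PrimeSpectrum S) :
    trdegAt k (PrimeSpectrum.comap f.toRingHom x) ≤ trdegAt k x :=
  eTrdeg_le_of_injective (Ideal.quotientMapₐ x.asIdeal f le_rfl)
    (Ideal.quotientMap_injective' (H := le_rfl) le_rfl)

theorem trdegAt_comap_of_surjective (f : B →ₐ[k] S) (hf : Function.Surjective f)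
    (x : PrimeSpectrum S) : trdegAt k (PrimeSpectrum.comap f.toRingHom x) = trdegAt k x :=
  (trdegAt_comap_le f x).antisymm
    (eTrdeg_le_of_surjective (Ideal.quotientMapₐ x.asIdeal f le_rfl)
      (Ideal.quotientMap_surjective (H := le_rfl) hf))

theorem heightAddTrdeg_comap_equiv (e : B ≃ₐ[k] S) (x : PrimeSpectrum S) :
    heightAddTrdeg k (PrimeSpectrum.comap e.toAlgHom.toRingHom x) = heightAddTrdeg k x := by
  rw [heightAddTrdeg, trdegAt_comap_of_surjective _ e.surjective, heightAddTrdeg]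
  congr 1
  exact Order.height_orderIso (PrimeSpectrum.comapEquiv e.symm.toRingEquiv) x

theorem BoundedTrdeg.exists_strictMono (h : BoundedTrdeg k S) :
    ∃ g : PrimeSpectrum S → ℕ, StrictMono g := by
  obtain ⟨N, hN⟩ := h
  refine ⟨fun x => N - (trdegAt k x).toNat, fun x y hxy => ?_⟩
  have h1 := trdegAt_add_one_le hxy (ne_top_of_le_ne_top (ENat.natCast_ne_top N) (hN x))
  have hx := hN x
  have hy := hN y
  change N - (trdegAt k x).toNat < N - (trdegAt k y).toNat
  generalize trdegAt k x = a at *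
  generalize trdegAt k y = b at *
  enat_to_nat
  simp only [ENat.toNat_natCast]
  omega

theorem BoundedTrdeg.wellFoundedLT (h : BoundedTrdeg k S) : WellFoundedLT (PrimeSpectrum S) :=
  let ⟨_, hg⟩ := h.exists_strictMono
  hg.wellFoundedLT

theorem BoundedTrdeg.height_ne_top (h : BoundedTrdeg k S) (x : PrimeSpectrum S) :
    Order.height x ≠ ⊤ := by
  obtain ⟨g, hg⟩ := h.exists_strictMono
  refine ne_top_of_le_ne_top ?_ (Order.height_le_height_apply_of_strictMono g hg x)
  simp

theorem BoundedTrdeg.of_eTrdeg_ne_top (h : eTrdeg k S ≠ ⊤) : BoundedTrdeg k S := by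
  obtain ⟨N, hN⟩ := ENat.ne_top_iff_exists.1 h
  exact ⟨N, fun x => hN ▸ eTrdeg_le_of_surjective (Ideal.Quotient.mkₐ k x.asIdeal)
    (Ideal.Quotient.mkₐ_surjective k x.asIdeal)⟩

theorem BoundedTrdeg.of_surjective (h : BoundedTrdeg k B) (f : B →ₐ[k] S)
    (hf : Function.Surjective f) : BoundedTrdeg k S :=
  let ⟨N, hN⟩ := h
  ⟨N, fun x => trdegAt_comap_of_surjective f hf x ▸ hN _⟩

theorem trdegAt_bot [IsDomain S] : trdegAt k (⊥ : PrimeSpectrum S) = eTrdeg k S :=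
  eTrdeg_congr (AlgEquiv.quotientBot k S)

end Spectrum

section Polynomial

open Polynomial

variable {k : Type u} [Field k] {B S : Type u} [CommRing B] [Algebra k B] [CommRing S] [Algebra k S]

/-- The extension of a prime to the polynomial ring in one variable. -/
def polyPoint (q : PrimeSpectrum B) : PrimeSpectrum B[X] :=
  ⟨q.asIdeal.map C, inferInstance⟩

theorem comap_C_polyPoint (q : PrimeSpectrum B) : PrimeSpectrum.comap C (polyPoint q) = q := by
  ext a
  change C a ∈ q.asIdeal.map C ↔ _
  rw [Ideal.mem_map_C_iff]
  refine ⟨fun h => by simpa using h 0, fun h n => ?_⟩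
  rw [coeff_C]
  split_ifs
  exacts [h, zero_mem _]

theorem polyPoint_comap_le (P : PrimeSpectrum B[X]) :
    polyPoint (PrimeSpectrum.comap (CAlgHom (R := k) (A := B)).toRingHom P) ≤ P :=
  Ideal.map_le_iff_le_comap.2 le_rfl

theorem polyPoint_strictMono : StrictMono (polyPoint : PrimeSpectrum B → PrimeSpectrum B[X]) := by
  refine Monotone.strictMono_of_injective (fun q q' h => Ideal.map_mono h) fun q q' h => ?_
  rw [← comap_C_polyPoint q, h, comap_C_polyPoint]

theorem trdegAt_polyPoint (q : PrimeSpectrum B) :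
    trdegAt k (polyPoint q) = trdegAt k q + 1 := by
  have h := trdegAt_comap_of_surjective (mapAlgHom (Ideal.Quotient.mkₐ k q.asIdeal))
    (map_surjective _ Ideal.Quotient.mk_surjective) ⊥
  rw [trdegAt_bot, eTrdeg_polynomial] at h
  change _ = eTrdeg k (B ⧸ q.asIdeal) + 1
  rw [← h]
  congr 1
  ext p
  change p ∈ q.asIdeal.map C ↔ Polynomial.map (Ideal.Quotient.mk q.asIdeal) p ∈ (⊥ : Ideal _)
  rw [Ideal.mem_map_C_iff, Ideal.mem_bot, Polynomial.ext_iff]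
  simp [Ideal.Quotient.eq_zero_iff_mem]

theorem trdegAt_le_comap_C_add_one (P : PrimeSpectrum B[X]) :
    trdegAt k P ≤ trdegAt k (PrimeSpectrum.comap (CAlgHom (R := k) (A := B)).toRingHom P) + 1 := by
  rw [← trdegAt_polyPoint]
  exact trdegAt_anti (polyPoint_comap_le P)

theorem BoundedTrdeg.polynomial (h : BoundedTrdeg k B) : BoundedTrdeg k B[X] := by
  obtain ⟨N, hN⟩ := h
  refine ⟨N + 1, fun P => (trdegAt_le_comap_C_add_one P).trans ?_⟩
  exact_mod_cast add_le_add_left (hN _) 1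

theorem trdegAt_of_polyPoint_lt (h : BoundedTrdeg k B) {P : PrimeSpectrum B[X]}
    (hP : polyPoint (PrimeSpectrum.comap (CAlgHom (R := k) (A := B)).toRingHom P) < P) :
    trdegAt k P = trdegAt k (PrimeSpectrum.comap (CAlgHom (R := k) (A := B)).toRingHom P) := by
  refine le_antisymm ?_ (trdegAt_comap_le _ P)
  have h1 := trdegAt_add_one_le hP (h.polynomial.ne_top _)
  rw [trdegAt_polyPoint] at h1
  exact (ENat.add_le_add_iff_right (by simp)).1 h1

theorem height_le_polyPoint_add_one (h : BoundedTrdeg k B) (P : PrimeSpectrum B[X]) :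
    Order.height P ≤ Order.height
      (polyPoint (PrimeSpectrum.comap (CAlgHom (R := k) (A := B)).toRingHom P)) + 1 := by
  have := h.polynomial.wellFoundedLT
  induction P using WellFoundedLT.induction with
  | ind P ih =>
  rcases (polyPoint_comap_le (k := k) P).eq_or_lt with hP | hP
  · rw [hP]
    exact le_self_add
  refine height_le_of_forall_lt fun P' hP' => add_le_add_left ?_ 1
  have hq : PrimeSpectrum.comap (CAlgHom (R := k) (A := B)).toRingHom P' ≤
      PrimeSpectrum.comap (CAlgHom (R := k) (A := B)).toRingHom P := Ideal.comap_mono hP'.le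
  rcases hq.eq_or_lt with hq | hq
  · rcases (polyPoint_comap_le (k := k) P').eq_or_lt with hP'' | hP''
    · rw [← hq, hP'']
    · have h1 := trdegAt_add_one_le hP' (h.polynomial.ne_top _)
      rw [trdegAt_of_polyPoint_lt h hP, trdegAt_of_polyPoint_lt h hP'', hq] at h1
      exact absurd h1 (ENat.lt_add_one_iff (h.ne_top _) |>.2 le_rfl).not_ge
  · exact (ih P' hP').trans (Order.height_add_one_le (polyPoint_strictMono hq))

theorem heightAddTrdeg_polynomial (h : BoundedTrdeg k B) (P : PrimeSpectrum B[X]) :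
    heightAddTrdeg k P = heightAddTrdeg k
      (polyPoint (PrimeSpectrum.comap (CAlgHom (R := k) (A := B)).toRingHom P)) := by
  rcases (polyPoint_comap_le (k := k) P).eq_or_lt with hP | hP
  · rw [hP]
  · rw [heightAddTrdeg, heightAddTrdeg, trdegAt_polyPoint, trdegAt_of_polyPoint_lt h hP,
      (height_le_polyPoint_add_one h P).antisymm (Order.height_add_one_le hP)]
    ring

end Polynomial

section MvPolynomial

open Polynomial

variable {k : Type u} [Field k] {B S S' : Type u} [CommRing B] [Algebra k B] [CommRing S]
  [Algebra k S] [CommRing S'] [Algebra k S']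

theorem BoundedTrdeg.congr (e : B ≃ₐ[k] S) (h : BoundedTrdeg k B) : BoundedTrdeg k S :=
  h.of_surjective e.toAlgHom e.surjective

theorem FibreConst.comp_equiv {f : B →ₐ[k] S} (hf : FibreConst k f) (e : S ≃ₐ[k] S') :
    FibreConst k (e.toAlgHom.comp f) := fun x y hxy => by
  rw [← heightAddTrdeg_comap_equiv e x, ← heightAddTrdeg_comap_equiv e y]
  exact hf _ _ hxy

theorem comap_map_C_polyPoint {f : B →ₐ[k] S} (Q : PrimeSpectrum S) :
    PrimeSpectrum.comap (Polynomial.mapAlgHom f).toRingHom (polyPoint Q) =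
      polyPoint (PrimeSpectrum.comap f.toRingHom Q) := by
  ext p
  change p.map f.toRingHom ∈ Q.asIdeal.map C ↔ p ∈ (Q.asIdeal.comap f.toRingHom).map C
  simp only [Ideal.mem_map_C_iff, Polynomial.coeff_map, Ideal.mem_comap]

theorem fibreConst_C_polynomial {f : B →ₐ[k] S} (hS : BoundedTrdeg k S)
    (hf : FibreConst k (Polynomial.mapAlgHom f)) :
    FibreConst k ((CAlgHom (R := k) (A := S)).comp f) := fun x y hxy => by
  rw [heightAddTrdeg_polynomial hS x, heightAddTrdeg_polynomial hS y]
  refine hf _ _ ?_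
  rw [comap_map_C_polyPoint, comap_map_C_polyPoint]
  exact congrArg polyPoint hxy

theorem fibreConst_mvPolynomial (σ : Type u) [Finite σ] : ∀ (B : Type u) [CommRing B]
    [Algebra k B], BoundedTrdeg k B → BoundedTrdeg k (MvPolynomial σ B) ∧
      FibreConst k (IsScalarTower.toAlgHom k B (MvPolynomial σ B)) := by
  induction σ using Finite.induction_empty_option with
  | of_equiv e ih =>
    intro B _ _ h
    obtain ⟨h1, h2⟩ := ih B h
    refine ⟨h1.congr (MvPolynomial.renameEquiv B e |>.restrictScalars k), ?_⟩
    convert h2.comp_equiv (MvPolynomial.renameEquiv B e |>.restrictScalars k)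
    ext b
    simp
  | h_empty =>
    intro B _ _ h
    let e : B ≃ₐ[k] MvPolynomial PEmpty B :=
      ((MvPolynomial.isEmptyAlgEquiv B PEmpty).symm.restrictScalars k)
    refine ⟨h.congr e, ?_⟩
    have h2 : FibreConst k (AlgHom.id k B) := fun x y hxy => by
      rw [show x = y from hxy]
    convert h2.comp_equiv e
    ext b
    simp [e]
  | h_option ih =>
    rename_i σ _
    intro B _ _ h
    obtain ⟨h1, -⟩ := ih B h
    let e1 : (MvPolynomial σ B)[X] ≃ₐ[k] MvPolynomial (Option σ) B :=
      (MvPolynomial.optionEquivLeft B σ).symm.restrictScalars k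
    let e2 : MvPolynomial σ B[X] ≃ₐ[k] (MvPolynomial σ B)[X] :=
      ((MvPolynomial.optionEquivRight B σ).symm.trans
        (MvPolynomial.optionEquivLeft B σ)).restrictScalars k
    refine ⟨h1.polynomial.congr e1, ?_⟩
    have h2 : FibreConst k (Polynomial.mapAlgHom
        (IsScalarTower.toAlgHom k B (MvPolynomial σ B))) := by
      convert (ih B[X] h.polynomial).2.comp_equiv e2
      ext b
      · simp [e2]
      · simp [e2]
    convert (fibreConst_C_polynomial h1 h2).comp_equiv e1
    ext b
    simp [e1]

/-- Polynomials over `B` as a tensor product over the base field. -/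
def mvPolynomialTensorEquiv (k : Type u) [Field k] (σ B : Type u) [CommRing B] [Algebra k B] :
    MvPolynomial σ k ⊗[k] B ≃ₐ[k] MvPolynomial σ B :=
  (Algebra.TensorProduct.comm k (MvPolynomial σ k) B).trans
    ((MvPolynomial.algebraTensorAlgEquiv k B).restrictScalars k)

theorem mvPolynomialTensorEquiv_one_tmul (σ : Type u) (b : B) :
    mvPolynomialTensorEquiv k σ B (1 ⊗ₜ b) = MvPolynomial.C b := by
  simp [mvPolynomialTensorEquiv, MvPolynomial.smul_eq_C_mul]

theorem fibreConst_mvPolynomial_tensor (σ : Type u) [Finite σ] (h : BoundedTrdeg k B) :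
    BoundedTrdeg k (MvPolynomial σ k ⊗[k] B) ∧ FibreConst k
      (Algebra.TensorProduct.includeRight : B →ₐ[k] MvPolynomial σ k ⊗[k] B) := by
  obtain ⟨h1, h2⟩ := fibreConst_mvPolynomial (k := k) σ B h
  let e := mvPolynomialTensorEquiv k σ B
  refine ⟨h1.congr e.symm, ?_⟩
  have he : Algebra.TensorProduct.includeRight = e.symm.toAlgHom.comp
      (IsScalarTower.toAlgHom k B (MvPolynomial σ B)) := by
    ext b
    exact e.eq_symm_apply.2 (mvPolynomialTensorEquiv_one_tmul σ b)
  rw [he]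
  exact h2.comp_equiv e.symm

end MvPolynomial

section TrdegBounds

variable {k : Type u} [Field k]

/-- If `S` is generated by the images of `T` and `B`, and `T` is algebraic over `k[Z ∪ Y]`,
then the transcendence degree of `S` is at most that of a subalgebra containing the images of
`B` and `Z` plus the cardinality of `Y`. -/
theorem eTrdeg_le_add_encard {T B S : Type u} [CommRing T] [CommRing B] [CommRing S] [IsDomain S]
    [Algebra k T] [Algebra k B] [Algebra k S] (f : T →ₐ[k] S) (g : B →ₐ[k] S)
    (hf : Function.Injective f) (hfg : f.range ⊔ g.range = ⊤) (Z Y : Set T)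
    [halg : Algebra.IsAlgebraic (Algebra.adjoin k (Z ∪ Y)) T] (R : Subalgebra k S)
    (hZ : ∀ z ∈ Z, f z ∈ R) (hg : g.range ≤ R) : eTrdeg k S ≤ eTrdeg k R + Y.encard := by
  obtain ⟨s, hs⟩ := exists_isTranscendenceBasis k R
  let A := Algebra.adjoin k (((↑) : R → S) '' s ∪ f '' Y)
  let C : Subalgebra A S := Subalgebra.algebraicClosure A S
  have hRC : R ≤ C.restrictScalars k := by
    intro r hr
    have := hs.isAlgebraic
    have hr' : IsAlgebraic (Algebra.adjoin k (Set.range ((↑) : s → R))) (⟨r, hr⟩ : R) :=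
      Algebra.IsAlgebraic.isAlgebraic _
    have hsub : (Algebra.adjoin k (Set.range ((↑) : s → R))).map R.val ≤ A := by
      rw [AlgHom.map_adjoin, Subtype.range_coe]
      exact Algebra.adjoin_mono Set.subset_union_left
    refine hr'.ringHom_of_comp_eq (S := A) (B := S)
      ((R.val.comp (Subalgebra.val _)).codRestrict A fun x => hsub ⟨x, x.2, rfl⟩).toRingHom
      R.val.toRingHom ?_ rfl
    intro a b hab
    exact Subtype.ext (Subtype.ext (congrArg (fun x : A => (x : S)) hab))
  have hfC : f.range ≤ C.restrictScalars k := by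
    rintro _ ⟨t, rfl⟩
    have ht : IsAlgebraic (Algebra.adjoin k (Z ∪ Y)) t := halg.isAlgebraic t
    have hsub : (Algebra.adjoin k (Z ∪ Y)).map f ≤ C.restrictScalars k := by
      rw [AlgHom.map_adjoin, Algebra.adjoin_le_iff, Set.image_union, Set.union_subset_iff]
      refine ⟨?_, ?_⟩
      · rintro _ ⟨z, hz, rfl⟩
        exact hRC (hZ z hz)
      · intro y hy
        exact C.algebraMap_mem ⟨y, Algebra.subset_adjoin (Or.inr hy)⟩
    have h1 : IsAlgebraic C (f t) := by
      refine ht.ringHom_of_comp_eq (S := C) (B := S)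
        ((f.comp (Subalgebra.val _)).codRestrict (C.restrictScalars k)
          fun x => hsub ⟨x, x.2, rfl⟩).toRingHom f.toRingHom ?_ rfl
      intro a b hab
      exact Subtype.ext (hf (congrArg Subtype.val hab))
    have : Algebra.IsAlgebraic A C :=
      inferInstanceAs (Algebra.IsAlgebraic A (Subalgebra.algebraicClosure A S))
    exact h1.restrictScalars A
  have htop : C.restrictScalars k = ⊤ :=
    top_le_iff.1 (hfg ▸ sup_le hfC (hg.trans hRC))
  refine (eTrdeg_le_encard (((↑) : R → S) '' s ∪ f '' Y) ⟨fun x => ?_⟩).trans ?_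
  · exact (htop ▸ Algebra.mem_top : x ∈ C.restrictScalars k)
  · refine (Set.encard_union_le _ _).trans (add_le_add ?_ (Set.encard_image_le _ _))
    exact (Set.encard_image_le _ _).trans (encard_eq_eTrdeg hs).le

variable {T B E : Type u} [CommRing T] [CommRing B] [CommRing E] [Algebra k T] [Algebra k B]
  [Algebra k E]

/-- The contraction to the left factor of a prime of a tensor product. -/
abbrev comapLeft (Q : PrimeSpectrum (T ⊗[k] B)) : PrimeSpectrum T :=
  PrimeSpectrum.comap (Algebra.TensorProduct.includeLeft : T →ₐ[k] T ⊗[k] B).toRingHom Q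

/-- The contraction to the right factor of a prime of a tensor product. -/
abbrev comapRight (Q : PrimeSpectrum (T ⊗[k] B)) : PrimeSpectrum B :=
  PrimeSpectrum.comap (Algebra.TensorProduct.includeRight : B →ₐ[k] T ⊗[k] B).toRingHom Q

theorem trdegAt_le_comap_add_encard (Q : PrimeSpectrum (T ⊗[k] B)) (α : E →ₐ[k] T ⊗[k] B)
    (hα : ∀ b : B, ∃ e, α e = 1 ⊗ₜ b) (Z Y : Set (T ⧸ (comapLeft Q).asIdeal))
    (halg : Algebra.IsAlgebraic (Algebra.adjoin k (Z ∪ Y)) (T ⧸ (comapLeft Q).asIdeal))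
    (hZ : ∀ z ∈ Z, ∃ e t, α e = t ⊗ₜ 1 ∧ Ideal.Quotient.mk (comapLeft Q).asIdeal t = z) :
    trdegAt k Q ≤ trdegAt k (PrimeSpectrum.comap α.toRingHom Q) + Y.encard := by
  let f : T ⧸ (comapLeft Q).asIdeal →ₐ[k] (T ⊗[k] B) ⧸ Q.asIdeal :=
    Ideal.quotientMapₐ Q.asIdeal Algebra.TensorProduct.includeLeft le_rfl
  let g : B →ₐ[k] (T ⊗[k] B) ⧸ Q.asIdeal :=
    (Ideal.Quotient.mkₐ k Q.asIdeal).comp Algebra.TensorProduct.includeRight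
  let φ : E ⧸ (PrimeSpectrum.comap α.toRingHom Q).asIdeal →ₐ[k] (T ⊗[k] B) ⧸ Q.asIdeal :=
    Ideal.quotientMapₐ Q.asIdeal α le_rfl
  refine (eTrdeg_le_add_encard f g (Ideal.quotientMap_injective' (H := le_rfl) le_rfl) ?_ Z Y
    φ.range ?_ ?_).trans
    (add_le_add_left (eTrdeg_le_of_surjective φ.rangeRestrict φ.rangeRestrict_surjective) _)
  · rw [eq_top_iff]
    rintro x -
    obtain ⟨x, rfl⟩ := Ideal.Quotient.mk_surjective x
    induction x with
    | zero => simp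
    | add x y hx hy => rw [map_add]; exact add_mem hx hy
    | tmul t b =>
      have h : t ⊗ₜ[k] b = t ⊗ₜ 1 * 1 ⊗ₜ b := by simp
      rw [h, map_mul]
      exact mul_mem (le_sup_left (a := f.range) ⟨Ideal.Quotient.mk _ t, rfl⟩)
        (le_sup_right (a := f.range) ⟨b, rfl⟩)
  · intro z hz
    obtain ⟨e, t, h1, rfl⟩ := hZ z hz
    exact ⟨Ideal.Quotient.mk _ e, congrArg (Ideal.Quotient.mk Q.asIdeal) h1⟩
  · rintro _ ⟨b, rfl⟩
    obtain ⟨e, he⟩ := hα b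
    exact ⟨Ideal.Quotient.mk _ e, congrArg (Ideal.Quotient.mk Q.asIdeal) he⟩

theorem trdegAt_le_add (Q : PrimeSpectrum (T ⊗[k] B)) :
    trdegAt k Q ≤ trdegAt k (comapLeft Q) + trdegAt k (comapRight Q) := by
  obtain ⟨s, hs⟩ := exists_isTranscendenceBasis k (T ⧸ (comapLeft Q).asIdeal)
  have halg := hs.isAlgebraic
  rw [Subtype.range_coe] at halg
  rw [add_comm, trdegAt.eq_1 k (comapLeft Q), ← encard_eq_eTrdeg hs]
  refine trdegAt_le_comap_add_encard Q Algebra.TensorProduct.includeRight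
    (fun b => ⟨b, rfl⟩) ∅ s ?_ (fun z hz => hz.elim)
  rwa [Set.empty_union]

theorem BoundedTrdeg.tensor (hT : BoundedTrdeg k T) (hB : BoundedTrdeg k B) :
    BoundedTrdeg k (T ⊗[k] B) := by
  obtain ⟨N, hN⟩ := hT
  obtain ⟨M, hM⟩ := hB
  exact ⟨N + M, fun Q => (trdegAt_le_add Q).trans (by exact_mod_cast add_le_add (hN _) (hM _))⟩

end TrdegBounds

section GoingDown

theorem exists_le_comap_eq_of_flat {R S : Type*} [CommRing R] [CommRing S] [Algebra R S]
    [Module.Flat R S] (Q : PrimeSpectrum S) {p : PrimeSpectrum R}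
    (h : p ≤ PrimeSpectrum.comap (algebraMap R S) Q) :
    ∃ P ≤ Q, PrimeSpectrum.comap (algebraMap R S) P = p := by
  have : Q.asIdeal.LiesOver (PrimeSpectrum.comap (algebraMap R S) Q).asIdeal := ⟨rfl⟩
  obtain ⟨P, hPQ, hP, hPp⟩ := Ideal.exists_ideal_le_liesOver_of_le Q.asIdeal h
  exact ⟨⟨P, hP⟩, hPQ, PrimeSpectrum.ext hPp.over.symm⟩

theorem flat_of_field_of_injective {E κ : Type*} [CommRing E] [IsDomain E] [Field κ] [Algebra E κ]
    (h : Function.Injective (algebraMap E κ)) : Module.Flat E κ := by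
  have : FaithfulSMul E κ := (faithfulSMul_iff_algebraMap_injective E κ).2 h
  let := FractionRing.liftAlgebra E κ
  have : IsScalarTower E (FractionRing E) κ := inferInstance
  have : Module.Flat E (FractionRing E) := IsLocalization.flat _ (nonZeroDivisors E)
  exact Module.Flat.trans E (FractionRing E) κ

/-- Going down inside a fibre of a cobase change: if `S` is the pushout of `T` and `R` over the
domain `E`, and `q` is a prime of `R` lying over zero in `E`, then going down to `T` holds among
the primes of `S` over `q`. -/
theorem exists_le_comap_eq_of_isPushout {E T R S : Type*} [CommRing E] [IsDomain E] [CommRing T]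
    [CommRing R] [CommRing S] [Algebra E T] [Algebra E R] [Algebra E S] [Algebra T S] [Algebra R S]
    [IsScalarTower E T S] [IsScalarTower E R S] [hpush : Algebra.IsPushout E R T S]
    (P : PrimeSpectrum S)
    (hP : PrimeSpectrum.comap (algebraMap E S) P = ⊥) {p : PrimeSpectrum T}
    (h : p ≤ PrimeSpectrum.comap (algebraMap T S) P) :
    ∃ P' ≤ P, PrimeSpectrum.comap (algebraMap R S) P' = PrimeSpectrum.comap (algebraMap R S) P ∧
      PrimeSpectrum.comap (algebraMap T S) P' = p := by
  set q := PrimeSpectrum.comap (algebraMap R S) P with hq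
  let κ := q.asIdeal.ResidueField
  have hE : Module.Flat E κ := by
    refine flat_of_field_of_injective ((injective_iff_map_eq_zero _).2 fun a ha => ?_)
    rw [IsScalarTower.algebraMap_apply E R κ, Ideal.algebraMap_residueField_eq_zero] at ha
    have ha' : a ∈ (PrimeSpectrum.comap (algebraMap E S) P).asIdeal := by
      change algebraMap E S a ∈ P.asIdeal
      rw [IsScalarTower.algebraMap_apply E R S]
      exact ha
    rw [hP] at ha'
    exact ha'
  let : Algebra S (κ ⊗[R] S) := Algebra.TensorProduct.rightAlgebra
  let : Algebra T (κ ⊗[R] S) := Algebra.compHom _ (algebraMap T S)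
  have : IsScalarTower T S (κ ⊗[R] S) := .of_algebraMap_eq fun _ => rfl
  have : IsScalarTower E S (κ ⊗[R] S) := .of_algebraMap_eq fun a => by
    change _ = (1 : κ) ⊗ₜ[R] algebraMap E S a
    rw [IsScalarTower.algebraMap_apply E R S, ← Algebra.TensorProduct.tmul_one_eq_one_tmul,
      ← IsScalarTower.algebraMap_apply]
    rfl
  have : IsScalarTower E T (κ ⊗[R] S) := .of_algebraMap_eq fun a => by
    rw [IsScalarTower.algebraMap_apply E S (κ ⊗[R] S), IsScalarTower.algebraMap_apply E T S]
    rfl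
  have hp : Algebra.IsPushout E κ T (κ ⊗[R] S) :=
    (Algebra.IsPushout.comp_iff E R T S (T := κ)).2 inferInstance
  have : Module.Flat T (κ ⊗[R] S) := Module.Flat.isBaseChange E T κ _ hp.symm.out
  let e := PrimeSpectrum.preimageOrderIsoFiber R S q
  have he (x) : PrimeSpectrum.comap (algebraMap T S) (e.symm x).1 =
      PrimeSpectrum.comap (algebraMap T (κ ⊗[R] S)) x := rfl
  obtain ⟨P', hP', hp'⟩ := exists_le_comap_eq_of_flat (R := T) (S := κ ⊗[R] S)
    (p := p) (e ⟨P, hq.symm⟩) (h.trans_eq (by rw [← he, e.symm_apply_apply]))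
  refine ⟨(e.symm P').1, ?_, (e.symm P').2, (he P').trans hp'⟩
  have h1 : e.symm P' ≤ ⟨P, hq.symm⟩ := by rwa [e.symm_apply_le]
  exact h1

variable {k : Type u} [Field k] {E T B : Type u} [CommRing E] [CommRing T] [CommRing B]
  [Algebra k E] [Algebra k T] [Algebra k B]

/-- The map `E ⊗ B → T ⊗ B` induced by `h : E → T`. -/
abbrev baseMap (B : Type u) [CommRing B] [Algebra k B] (h : E →ₐ[k] T) :
    E ⊗[k] B →ₐ[k] T ⊗[k] B :=
  Algebra.TensorProduct.map h (AlgHom.id k B)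

theorem exists_le_comapLeft_eq [IsDomain E] (h : E →ₐ[k] T) (P : PrimeSpectrum (T ⊗[k] B))
    (hP : PrimeSpectrum.comap h.toRingHom (comapLeft P) = ⊥) {p : PrimeSpectrum T}
    (hp : p ≤ comapLeft P) :
    ∃ P' ≤ P, PrimeSpectrum.comap (baseMap B h).toRingHom P' =
      PrimeSpectrum.comap (baseMap B h).toRingHom P ∧ comapLeft P' = p := by
  let : Algebra E T := h.toAlgebra
  let : Algebra (E ⊗[k] B) (T ⊗[k] B) := (baseMap B h).toAlgebra
  have : IsScalarTower k E T := .of_algHom h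
  have : IsScalarTower E (E ⊗[k] B) (T ⊗[k] B) := .of_algebraMap_eq fun a => by
    change h a ⊗ₜ 1 = baseMap B h (a ⊗ₜ 1)
    simp
  have hpush : Algebra.IsPushout E T (E ⊗[k] B) (T ⊗[k] B) :=
    .tensorProduct_tensorProduct k B E T (by
      ext b
      change baseMap B h (1 ⊗ₜ b) = 1 ⊗ₜ b
      simp)
  exact exists_le_comap_eq_of_isPushout (hpush := hpush.symm) P hP hp

theorem exists_le_comap_baseMap_eq [IsDomain E] (h : E →ₐ[k] T) (P : PrimeSpectrum (T ⊗[k] B))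
    (hP : PrimeSpectrum.comap h.toRingHom (comapLeft P) = ⊥) {r : PrimeSpectrum (E ⊗[k] B)}
    (hr : r ≤ PrimeSpectrum.comap (baseMap B h).toRingHom P) :
    ∃ P' ≤ P, comapLeft P' = comapLeft P ∧
      PrimeSpectrum.comap (baseMap B h).toRingHom P' = r := by
  let : Algebra E T := h.toAlgebra
  let : Algebra (E ⊗[k] B) (T ⊗[k] B) := (baseMap B h).toAlgebra
  have : IsScalarTower k E T := .of_algHom h
  have : IsScalarTower E (E ⊗[k] B) (T ⊗[k] B) := .of_algebraMap_eq fun a => by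
    change h a ⊗ₜ 1 = baseMap B h (a ⊗ₜ 1)
    simp
  have hpush : Algebra.IsPushout E T (E ⊗[k] B) (T ⊗[k] B) :=
    .tensorProduct_tensorProduct k B E T (by
      ext b
      change baseMap B h (1 ⊗ₜ b) = 1 ⊗ₜ b
      simp)
  exact exists_le_comap_eq_of_isPushout (hpush := hpush) P hP hr

theorem comapRight_comap_baseMap (h : E →ₐ[k] T) (P : PrimeSpectrum (T ⊗[k] B)) :
    comapRight (PrimeSpectrum.comap (baseMap B h).toRingHom P) = comapRight P := by
  ext b
  change baseMap B h (1 ⊗ₜ b) ∈ P.asIdeal ↔ 1 ⊗ₜ b ∈ P.asIdeal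
  simp

end GoingDown

section Comparison

variable {k : Type u} [Field k] {T B : Type u} [CommRing T] [CommRing B] [Algebra k T] [Algebra k B]

theorem baseMap_tmul {E : Type u} [CommRing E] [Algebra k E] (h : E →ₐ[k] T) (e : E) (b : B) :
    baseMap B h (e ⊗ₜ b) = h e ⊗ₜ b := by
  simp

theorem height_comp_le_of_going_down {α β : Type*} [PartialOrder α] [PartialOrder β]
    [WellFoundedLT α] (g : α → β) (C : α → Prop)
    (hg : ∀ x, C x → ∀ r ≤ g x, ∃ x' ≤ x, C x' ∧ g x' = r) (x : α) (hx : C x) :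
    Order.height (g x) ≤ Order.height x := by
  induction x using WellFoundedLT.induction with
  | ind x ih =>
  refine height_le_of_forall_lt fun r hr => ?_
  obtain ⟨x', hx', hC, rfl⟩ := hg x hx r hr.le
  have hlt : x' < x := hx'.lt_of_ne (by rintro rfl; exact hr.ne rfl)
  exact (add_le_add_left (ih x' hlt hC) 1).trans (Order.height_add_one_le hlt)

theorem exists_le_comapLeft_eq_trdegAt_le (P : PrimeSpectrum (T ⊗[k] B)) {p' : PrimeSpectrum T}
    (hp' : p' ≤ comapLeft P) :
    ∃ P' ≤ P, comapLeft P' = p' ∧ comapRight P' = comapRight P ∧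
      trdegAt k P' + trdegAt k (comapLeft P) ≤ trdegAt k P + trdegAt k p' := by
  obtain ⟨s, hs⟩ := exists_isTranscendenceBasis k (T ⧸ (comapLeft P).asIdeal)
  let ζ : s → T := fun z => Function.surjInv Ideal.Quotient.mk_surjective z.1
  have hζ : (Ideal.Quotient.mkₐ k (comapLeft P).asIdeal) ∘ ζ = ((↑) : s → _) :=
    funext fun z => Function.surjInv_eq Ideal.Quotient.mk_surjective z.1
  let h : MvPolynomial s k →ₐ[k] T := MvPolynomial.aeval ζ
  have hind : AlgebraicIndependent k ((Ideal.Quotient.mkₐ k (comapLeft P).asIdeal) ∘ ζ) :=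
    hζ ▸ hs.1
  have hbot : PrimeSpectrum.comap h.toRingHom (comapLeft P) = ⊥ := by
    ext f
    refine ⟨fun hf => (injective_iff_map_eq_zero _).1 hind f ?_, fun hf => ?_⟩
    · refine (MvPolynomial.comp_aeval_apply ζ _ f).symm.trans ?_
      exact Ideal.Quotient.eq_zero_iff_mem.2 hf
    · rw [show f = 0 from hf]
      exact zero_mem _
  obtain ⟨P', hP', hβ, rfl⟩ := exists_le_comapLeft_eq h P hbot hp'
  have hr : comapRight P' = comapRight P := by
    rw [← comapRight_comap_baseMap h P', hβ, comapRight_comap_baseMap]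
  refine ⟨P', hP', rfl, hr, ?_⟩
  have hind' : AlgebraicIndependent k ((Ideal.Quotient.mkₐ k (comapLeft P').asIdeal) ∘ ζ) := by
    refine AlgebraicIndependent.of_comp (Ideal.Quotient.factorₐ k
      (show (comapLeft P').asIdeal ≤ (comapLeft P).asIdeal from hp')) ?_
    exact hind
  obtain ⟨t, hZt, ht⟩ := exists_isTranscendenceBasis_superset (R := k)
    (AlgebraicIndependent.coe_range hind')
  set Z := Set.range ((Ideal.Quotient.mkₐ k (comapLeft P').asIdeal) ∘ ζ) with hZ
  have halg := ht.isAlgebraic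
  rw [Subtype.range_coe, ← Set.union_sdiff_cancel hZt] at halg
  have h1 := trdegAt_le_comap_add_encard P' (baseMap B h)
    (fun b => ⟨1 ⊗ₜ b, by rw [baseMap_tmul, map_one]⟩) Z (t \ Z)
    halg (by
      rintro _ ⟨z, rfl⟩
      exact ⟨MvPolynomial.X z ⊗ₜ 1, ζ z, by rw [baseMap_tmul, MvPolynomial.aeval_X], rfl⟩)
  rw [hβ] at h1
  have hcard : Z.encard = trdegAt k (comapLeft P) := by
    rw [trdegAt, ← encard_eq_eTrdeg hs, hZ, ← Set.image_univ,
      (AlgebraicIndependent.injective hind').injOn.encard_image, Set.encard_univ,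
      ← ENat.card_coe_set_eq]
  have hcard' : trdegAt k (comapLeft P') = Z.encard + (t \ Z).encard := by
    rw [trdegAt, ← encard_eq_eTrdeg ht, add_comm, Set.encard_sdiff_add_encard_of_subset hZt]
  rw [hcard', hcard, add_comm _ (t \ Z).encard, ← add_assoc]
  exact add_le_add_left (h1.trans (add_le_add_left (trdegAt_comap_le _ P) _)) _

theorem exists_trdegAt_le_comap_baseMap (σ : Type u) [Finite σ] (P : PrimeSpectrum (T ⊗[k] B))
    (hσ : trdegAt k (comapLeft P) ≤ ENat.card σ) :
    ∃ h : MvPolynomial σ k →ₐ[k] T,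
      trdegAt k P ≤ trdegAt k (PrimeSpectrum.comap (baseMap B h).toRingHom P) := by
  obtain ⟨s, hs⟩ := exists_isTranscendenceBasis k (T ⧸ (comapLeft P).asIdeal)
  rw [trdegAt, ← encard_eq_eTrdeg hs, ← ENat.card_coe_set_eq] at hσ
  have hs_fin : Cardinal.mk s ≤ Cardinal.mk σ :=
    (Cardinal.toENat_le_iff_of_lt_aleph0 (Cardinal.lt_aleph0_of_finite σ)).1 hσ
  obtain ⟨e⟩ := hs_fin
  let ζ : σ → T := Function.extend e
    (fun z : s => Function.surjInv Ideal.Quotient.mk_surjective z.1) 0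
  refine ⟨MvPolynomial.aeval ζ, ?_⟩
  have halg := hs.isAlgebraic
  rw [Subtype.range_coe, ← Set.union_empty s] at halg
  have h1 := trdegAt_le_comap_add_encard P (baseMap B (MvPolynomial.aeval ζ))
    (fun b => ⟨1 ⊗ₜ b, by rw [baseMap_tmul, map_one]⟩) s ∅ halg fun z hz =>
      ⟨MvPolynomial.X (e ⟨z, hz⟩) ⊗ₜ 1, _, by
        rw [baseMap_tmul, MvPolynomial.aeval_X]
        exact congrArg (· ⊗ₜ[k] (1 : B)) (e.injective.extend_apply _ _ _),
        Function.surjInv_eq Ideal.Quotient.mk_surjective z⟩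
  rwa [Set.encard_empty, add_zero] at h1

end Comparison

section Fibres

variable {k : Type u} [Field k] {T B : Type u} [CommRing T] [CommRing B] [Algebra k T] [Algebra k B]

theorem height_add_le_of_forall_lt {α : Type*} [Preorder α] {x : α} {m N : ℕ∞} (hm : m ≤ N)
    (h : ∀ y < x, Order.height y + 1 + m ≤ N) : Order.height x + m ≤ N := by
  rcases eq_or_ne m ⊤ with rfl | hfin
  · simp [top_le_iff.1 hm]
  · have hc : AddLECancellable m := ENat.addLECancellable_of_ne_top hfin
    exact (add_le_add_left (height_le_of_forall_lt fun y hy =>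
      hc.le_tsub_of_add_le_right (h y hy)) m).trans (tsub_add_cancel_of_le hm).le

theorem heightAddTrdeg_le_of_comapRight_eq (σ : Type u) [Finite σ]
    (hσ : ∀ p : PrimeSpectrum T, trdegAt k p ≤ ENat.card σ) (hT : BoundedTrdeg k T)
    (hB : BoundedTrdeg k B) (P : PrimeSpectrum (T ⊗[k] B))
    (y : PrimeSpectrum (MvPolynomial σ k ⊗[k] B)) (hy : comapRight P = comapRight y) :
    heightAddTrdeg k P ≤ heightAddTrdeg k y := by
  obtain ⟨hbdd, hconst⟩ := fibreConst_mvPolynomial_tensor σ hB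
  have hbdd' := hT.tensor hB
  have := hbdd'.wellFoundedLT
  induction P using WellFoundedLT.induction generalizing y with
  | ind P ih =>
  obtain ⟨h, hh⟩ := exists_trdegAt_le_comap_baseMap σ P (hσ _)
  have h0 : heightAddTrdeg k (PrimeSpectrum.comap (baseMap B h).toRingHom P) =
      heightAddTrdeg k y :=
    hconst _ _ ((comapRight_comap_baseMap h P).trans hy)
  rw [← h0]
  refine height_add_le_of_forall_lt (hh.trans le_add_self) fun P' hP' => ?_
  have hle : PrimeSpectrum.comap (baseMap B h).toRingHom P' ≤
      PrimeSpectrum.comap (baseMap B h).toRingHom P := Ideal.comap_mono hP'.le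
  have hfin := hbdd'.ne_top P'
  have h1 := ih P' hP' _ (comapRight_comap_baseMap h P').symm
  rcases hle.eq_or_lt with heq | hlt
  · rw [heq] at h1
    refine le_trans ?_ h1
    rw [add_assoc, add_comm 1]
    exact add_le_add_right (trdegAt_add_one_le hP' hfin) _
  · have h2 := (ENat.add_le_add_iff_right hfin).1
      (h1.trans (add_le_add_right (trdegAt_comap_le (baseMap B h) P') _))
    exact add_le_add ((add_le_add_left h2 1).trans (Order.height_add_one_le hlt)) hh

variable [IsDomain T]

theorem heightAddTrdeg_le_of_comapLeft_eq_bot {σ : Type u} [Finite σ] (h : MvPolynomial σ k →ₐ[k] T)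
    (hh : Function.Injective h) (hT : BoundedTrdeg k T) (hB : BoundedTrdeg k B)
    (P : PrimeSpectrum (T ⊗[k] B)) (hP : comapLeft P = ⊥)
    (y : PrimeSpectrum (MvPolynomial σ k ⊗[k] B)) (hy : comapRight P = comapRight y) :
    heightAddTrdeg k y ≤ heightAddTrdeg k P := by
  have := (hT.tensor hB).wellFoundedLT
  have hbot : PrimeSpectrum.comap h.toRingHom (⊥ : PrimeSpectrum T) = ⊥ :=
    PrimeSpectrum.ext ((RingHom.ker_eq_comap_bot _).symm.trans
      ((RingHom.injective_iff_ker_eq_bot _).1 hh))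
  rw [← (fibreConst_mvPolynomial_tensor σ hB).2 _ _ ((comapRight_comap_baseMap h P).trans hy)]
  refine add_le_add (height_comp_le_of_going_down
    (PrimeSpectrum.comap (baseMap B h).toRingHom) (fun x => comapLeft x = ⊥) ?_ P hP)
    (trdegAt_comap_le _ P)
  intro x hx r hr
  obtain ⟨x', hx', h1, h2⟩ := exists_le_comap_baseMap_eq h x (by rw [hx, hbot]) hr
  exact ⟨x', hx', h1.trans hx, h2⟩

theorem le_heightAddTrdeg_of_comapRight_eq {σ : Type u} [Finite σ] (h : MvPolynomial σ k →ₐ[k] T)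
    (hh : Function.Injective h) (hT : BoundedTrdeg k T) (hB : BoundedTrdeg k B)
    (hAF : ∀ p : PrimeSpectrum T, heightAddTrdeg k p = eTrdeg k T)
    (P : PrimeSpectrum (T ⊗[k] B))
    (y : PrimeSpectrum (MvPolynomial σ k ⊗[k] B)) (hy : comapRight P = comapRight y) :
    heightAddTrdeg k y ≤ heightAddTrdeg k P := by
  obtain ⟨n, hn⟩ := ENat.ne_top_iff_exists.1 (hT.height_ne_top (comapLeft P))
  induction n generalizing P with
  | zero =>
    refine heightAddTrdeg_le_of_comapLeft_eq_bot h hh hT hB P ?_ y hy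
    exact (Order.height_eq_zero.1 hn.symm).eq_bot
  | succ n ih =>
    obtain ⟨p', hp', hn'⟩ : ∃ p' < comapLeft P, Order.height p' = n :=
      (Order.height_eq_coe_add_one_iff.1 hn.symm).2.1
    obtain ⟨P', hP', rfl, hr, hle⟩ := exists_le_comapLeft_eq_trdegAt_le P hp'.le
    have hlt : P' < P := hP'.lt_of_ne (by rintro rfl; exact hp'.ne rfl)
    refine (ih P' (hr.trans hy) hn'.symm).trans ?_
    have h1 := Order.height_add_one_le hlt
    have h2 := (hAF (comapLeft P')).trans (hAF (comapLeft P)).symm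
    unfold heightAddTrdeg at h2 ⊢
    rw [hn', ← hn] at h2
    have h3 : trdegAt k (comapLeft P') ≤ trdegAt k (comapLeft P) + 1 := by
      rw [Nat.cast_add, Nat.cast_one, add_assoc, add_comm 1] at h2
      exact (ENat.add_le_add_iff_left (ENat.natCast_ne_top n)).1 h2.le
    have h4 : trdegAt k P' ≤ trdegAt k P + 1 := by
      refine (ENat.add_le_add_iff_right (hT.ne_top (comapLeft P))).1 (hle.trans ?_)
      rw [add_right_comm, add_assoc]
      exact add_le_add_right h3 _
    refine (add_le_add_right h4 _).trans ?_
    rw [add_comm (trdegAt k P), ← add_assoc]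
    exact add_le_add_left h1 _

end Fibres

section AFDomain

variable {k : Type u} [Field k] {T B : Type u} [CommRing T] [IsDomain T] [CommRing B]
  [Algebra k T] [Algebra k B]

theorem exists_finite_isTranscendenceBasis (hT : eTrdeg k T ≠ ⊤) :
    ∃ s : Set T, s.Finite ∧ IsTranscendenceBasis k ((↑) : s → T) := by
  obtain ⟨s, hs⟩ := exists_isTranscendenceBasis k T
  exact ⟨s, Set.encard_ne_top_iff.1 (encard_eq_eTrdeg hs ▸ hT), hs⟩

/-- If `T` is an AF-domain then `heightAddTrdeg` of a prime of `T ⊗[k] B` depends only on its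
contraction to `B`. -/
theorem fibreConst_includeRight (hT : eTrdeg k T ≠ ⊤)
    (hAF : ∀ p : PrimeSpectrum T, heightAddTrdeg k p = eTrdeg k T) (hB : BoundedTrdeg k B) :
    FibreConst k (Algebra.TensorProduct.includeRight : B →ₐ[k] T ⊗[k] B) := by
  obtain ⟨s, hfin, hs⟩ := exists_finite_isTranscendenceBasis hT
  have := hfin.to_subtype
  have hbdd := BoundedTrdeg.of_eTrdeg_ne_top hT
  have key (x y : PrimeSpectrum (T ⊗[k] B)) (hxy : comapRight x = comapRight y) :
      heightAddTrdeg k x ≤ heightAddTrdeg k y := by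
    let h : MvPolynomial s k →ₐ[k] T := MvPolynomial.aeval (↑)
    have hz := comapRight_comap_baseMap h x
    refine (heightAddTrdeg_le_of_comapRight_eq s (fun p => ?_) hbdd hB x _ hz.symm).trans
      (le_heightAddTrdeg_of_comapRight_eq h hs.1 hbdd hB hAF y _ (hz.trans hxy).symm)
    rw [ENat.card_coe_set_eq, encard_eq_eTrdeg hs, ← hAF p]
    exact le_add_self
  exact fun x y hxy => (key x y hxy).antisymm (key y x hxy.symm)

theorem eTrdeg_mvPolynomial (σ B : Type u) [CommRing B] [IsDomain B] [Algebra k B] :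
    eTrdeg k (MvPolynomial σ B) = eTrdeg k B + ENat.card σ := by
  rw [← eTrdeg_add_eq k B (MvPolynomial σ B), eTrdeg_eq_toENat_trdeg B,
    MvPolynomial.trdeg_of_isDomain, Cardinal.lift_id]
  rfl

theorem exists_comapRight_eq_bot (σ : Type u) [IsDomain B] :
    ∃ y : PrimeSpectrum (MvPolynomial σ k ⊗[k] B), comapRight y = ⊥ ∧
      eTrdeg k B + ENat.card σ ≤ heightAddTrdeg k y := by
  refine ⟨PrimeSpectrum.comap (mvPolynomialTensorEquiv k σ B).toAlgHom.toRingHom ⊥, ?_, ?_⟩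
  · ext b
    change mvPolynomialTensorEquiv k σ B (1 ⊗ₜ b) = 0 ↔ b = 0
    rw [mvPolynomialTensorEquiv_one_tmul, MvPolynomial.C_eq_zero]
  · rw [heightAddTrdeg_comap_equiv, heightAddTrdeg, trdegAt_bot, eTrdeg_mvPolynomial]
    exact le_add_self

theorem eTrdeg_add_le_heightAddTrdeg [IsDomain B] (hT : eTrdeg k T ≠ ⊤) (hB : eTrdeg k B ≠ ⊤)
    (P : PrimeSpectrum (T ⊗[k] B)) (hl : comapLeft P = ⊥) (hr : comapRight P = ⊥) :
    eTrdeg k T + eTrdeg k B ≤ heightAddTrdeg k P := by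
  obtain ⟨s, hfin, hs⟩ := exists_finite_isTranscendenceBasis hT
  have := hfin.to_subtype
  obtain ⟨y, hy, hle⟩ := exists_comapRight_eq_bot (k := k) (B := B) s
  rw [ENat.card_coe_set_eq, encard_eq_eTrdeg hs, add_comm] at hle
  have hT' := BoundedTrdeg.of_eTrdeg_ne_top hT
  have hB' := BoundedTrdeg.of_eTrdeg_ne_top hB
  let h : MvPolynomial s k →ₐ[k] T := MvPolynomial.aeval (↑)
  have key := heightAddTrdeg_le_of_comapLeft_eq_bot h hs.1 hT' hB' P hl y (hr.trans hy.symm)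
  exact hle.trans key

theorem idealHt_asIdeal {R : Type*} [CommRing R] (x : PrimeSpectrum R) :
    idealHt x.asIdeal = Order.height x :=
  le_antisymm (iInf_le (fun P : {P : PrimeSpectrum R // x.asIdeal ≤ P.asIdeal} =>
    Order.height P.1) ⟨x, le_rfl⟩) (le_iInf fun y => Order.height_mono y.2)

theorem IsAFDomain.heightAddTrdeg_eq (h : IsAFDomain k T) (p : PrimeSpectrum T) :
    heightAddTrdeg k p = eTrdeg k T := by
  rw [← h p.asIdeal p.isPrime, idealHt_asIdeal, heightAddTrdeg, trdegAt]

end AFDomain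

section QuotientTensor

variable {k : Type u} [Field k] {A B C D : Type u} [CommRing A] [CommRing B] [CommRing C]
  [CommRing D] [Algebra k A] [Algebra k B] [Algebra k C] [Algebra k D]

theorem comap_le_comap_iff_of_surjective {R S : Type*} [CommRing R] [CommRing S] (f : R →+* S)
    (hf : Function.Surjective f) {x y : PrimeSpectrum S} :
    PrimeSpectrum.comap f x ≤ PrimeSpectrum.comap f y ↔ x ≤ y :=
  Ideal.comap_le_comap_iff_of_surjective f hf _ _

theorem strictMono_comap_of_surjective {R S : Type*} [CommRing R] [CommRing S] (f : R →+* S)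
    (hf : Function.Surjective f) : StrictMono (PrimeSpectrum.comap f) :=
  strictMono_of_le_iff_le fun _ _ => (comap_le_comap_iff_of_surjective f hf).symm

theorem exists_comap_eq_of_ker_le {R S : Type*} [CommRing R] [CommRing S] (f : R →+* S)
    (hf : Function.Surjective f) (x : PrimeSpectrum R) (hx : RingHom.ker f ≤ x.asIdeal) :
    ∃ y, PrimeSpectrum.comap f y = x := by
  have : x ∈ PrimeSpectrum.zeroLocus (RingHom.ker f) := hx
  rwa [← range_comap_of_surjective _ f hf] at this

theorem exists_le_comapRight_eq (P : PrimeSpectrum (A ⊗[k] B)) {q : PrimeSpectrum B}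
    (hq : q ≤ comapRight P) : ∃ P' ≤ P, comapLeft P' = comapLeft P ∧ comapRight P' = q := by
  let e := Algebra.TensorProduct.lid k B
  have he (x : k ⊗[k] B) : x = 1 ⊗ₜ e x := e.injective (by simp [e])
  obtain ⟨P', hP', h1, h2⟩ := exists_le_comap_baseMap_eq (Algebra.ofId k A) P
    (r := PrimeSpectrum.comap e.toAlgHom.toRingHom q)
    (PrimeSpectrum.ext ((Ideal.eq_bot_or_top _).resolve_right
      (PrimeSpectrum.isPrime _).ne_top)) (fun x hx => by
      rw [he x]
      change baseMap B (Algebra.ofId k A) (1 ⊗ₜ e x) ∈ P.asIdeal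
      rw [baseMap_tmul, map_one]
      exact hq hx)
  refine ⟨P', hP', h1, ?_⟩
  rw [← comapRight_comap_baseMap (Algebra.ofId k A) P', h2]
  ext b
  change e (1 ⊗ₜ b) ∈ q.asIdeal ↔ b ∈ q.asIdeal
  simp [e]

theorem exists_le_comapLeft_eq_bot [IsDomain A] [IsDomain B] (P : PrimeSpectrum (A ⊗[k] B)) :
    ∃ P' ≤ P, comapLeft P' = ⊥ ∧ comapRight P' = ⊥ := by
  obtain ⟨P₁, h₁, hl, -⟩ := exists_le_comapLeft_eq_trdegAt_le P (p' := ⊥) bot_le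
  obtain ⟨P₂, h₂, hl', hr⟩ := exists_le_comapRight_eq P₁ (q := ⊥) bot_le
  exact ⟨P₂, h₂.trans h₁, hl'.trans hl, hr⟩

variable (f : A →ₐ[k] D) (g : B →ₐ[k] C)

theorem comapLeft_comap_map (y : PrimeSpectrum (D ⊗[k] C)) :
    comapLeft (PrimeSpectrum.comap (Algebra.TensorProduct.map f g).toRingHom y) =
      PrimeSpectrum.comap f.toRingHom (comapLeft y) := by
  ext a
  change Algebra.TensorProduct.map f g (a ⊗ₜ 1) ∈ y.asIdeal ↔ f a ⊗ₜ 1 ∈ y.asIdeal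
  simp

theorem comapRight_comap_map (y : PrimeSpectrum (D ⊗[k] C)) :
    comapRight (PrimeSpectrum.comap (Algebra.TensorProduct.map f g).toRingHom y) =
      PrimeSpectrum.comap g.toRingHom (comapRight y) := by
  ext a
  change Algebra.TensorProduct.map f g (1 ⊗ₜ a) ∈ y.asIdeal ↔ 1 ⊗ₜ g a ∈ y.asIdeal
  simp

variable {f g}

theorem tensorProduct_map_surjective (hf : Function.Surjective f) (hg : Function.Surjective g) :
    Function.Surjective (Algebra.TensorProduct.map f g).toRingHom :=
  TensorProduct.map_surjective (g := f.toLinearMap) (g' := g.toLinearMap) hf hg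

theorem exists_comap_map_eq (hf : Function.Surjective f) (hg : Function.Surjective g)
    (P : PrimeSpectrum (A ⊗[k] B))
    (hl : RingHom.ker f ≤ (comapLeft P).asIdeal) (hr : RingHom.ker g ≤ (comapRight P).asIdeal) :
    ∃ y, PrimeSpectrum.comap (Algebra.TensorProduct.map f g).toRingHom y = P := by
  refine exists_comap_eq_of_ker_le _ (tensorProduct_map_surjective hf hg) P ?_
  refine (Algebra.TensorProduct.map_ker f g hf hg).trans_le (sup_le ?_ ?_)
  · exact Ideal.map_le_iff_le_comap.2 hl
  · exact Ideal.map_le_iff_le_comap.2 hr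

end QuotientTensor

section Criterion

theorem exists_le_height_comp_add_le {α β : Type*} [PartialOrder α] [PartialOrder β] {g : α → β}
    (hg : StrictMono g) (x : α) (hx : Order.height x ≠ ⊤) :
    ∃ y ≤ x, Order.height y = 0 ∧ Order.height (g y) + Order.height x ≤ Order.height (g x) := by
  obtain ⟨n, hn⟩ := ENat.ne_top_iff_exists.1 hx
  clear hx
  induction n generalizing x with
  | zero => exact ⟨x, le_rfl, hn.symm, by rw [← hn]; simp⟩
  | succ n ih =>
    obtain ⟨z, hz, hzn⟩ := (Order.height_eq_coe_add_one_iff.1 hn.symm).2.1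
    obtain ⟨y, hy, h0, hle⟩ := ih z hzn.symm
    refine ⟨y, hy.trans hz.le, h0, ?_⟩
    rw [← hn, Nat.cast_add, Nat.cast_one, ← add_assoc, ← hzn]
    exact (add_le_add_left hle 1).trans (Order.height_add_one_le (hg hz))

theorem idealHt_add_height_le {R S : Type*} [CommRing R] [CommRing S] (f : R →+* S)
    (hf : Function.Surjective f) (x : PrimeSpectrum S) (hx : Order.height x ≠ ⊤) :
    idealHt (RingHom.ker f) + Order.height x ≤ Order.height (PrimeSpectrum.comap f x) := by
  obtain ⟨y, -, -, hle⟩ := exists_le_height_comp_add_le (strictMono_comap_of_surjective f hf) x hx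
  refine (add_le_add_left ?_ _).trans hle
  exact iInf_le (fun P : {P : PrimeSpectrum R // RingHom.ker f ≤ P.asIdeal} => Order.height P.1)
    ⟨_, Ideal.comap_mono bot_le⟩

theorem exists_height_eq_idealHt {R : Type*} [CommRing R] {I : Ideal R} {x : PrimeSpectrum R}
    (hx : I ≤ x.asIdeal) : ∃ y : PrimeSpectrum R, I ≤ y.asIdeal ∧ Order.height y = idealHt I := by
  have : Nonempty {P : PrimeSpectrum R // I ≤ P.asIdeal} := ⟨⟨x, hx⟩⟩
  obtain ⟨y, hy⟩ := ciInf_mem fun P : {P : PrimeSpectrum R // I ≤ P.asIdeal} => Order.height P.1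
  exact ⟨y.1, y.2, hy⟩

variable {k : Type u} [Field k] {A B : Type u} [CommRing A] [CommRing B] [Algebra k A]
  [Algebra k B]

/-- The extension to `A ⊗[k] B` of the two contractions of a prime of `A ⊗[k] B`. -/
abbrev contractionIdeal (P : PrimeSpectrum (A ⊗[k] B)) : Ideal (A ⊗[k] B) :=
  (comapLeft P).asIdeal.map (Algebra.TensorProduct.includeLeft : A →ₐ[k] A ⊗[k] B).toRingHom ⊔
    (comapRight P).asIdeal.map (Algebra.TensorProduct.includeRight : B →ₐ[k] A ⊗[k] B).toRingHom

theorem contractionIdeal_le (P : PrimeSpectrum (A ⊗[k] B)) : contractionIdeal P ≤ P.asIdeal :=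
  sup_le Ideal.map_comap_le Ideal.map_comap_le

theorem height_eq_idealHt_add (hA : eTrdeg k A ≠ ⊤) (hB : eTrdeg k B ≠ ⊤)
    (h : ∀ P Q : PrimeSpectrum (A ⊗[k] B), comapLeft P = comapLeft Q →
      comapRight P = comapRight Q → heightAddTrdeg k P ≤ heightAddTrdeg k Q)
    (P : PrimeSpectrum (A ⊗[k] B)) :
    Order.height P = idealHt (contractionIdeal P) +
      idealHt (P.asIdeal.map (Ideal.Quotient.mk (contractionIdeal P))) := by
  have hbdd := (BoundedTrdeg.of_eTrdeg_ne_top hA).tensor (BoundedTrdeg.of_eTrdeg_ne_top hB)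
  set C := contractionIdeal P with hC
  have hCP : C ≤ P.asIdeal := contractionIdeal_le P
  have hsurj : Function.Surjective (Ideal.Quotient.mk C) := Ideal.Quotient.mk_surjective
  obtain ⟨x', hx'⟩ := exists_comap_eq_of_ker_le (Ideal.Quotient.mk C) hsurj P
    (Ideal.mk_ker.trans_le hCP)
  have hmap : P.asIdeal.map (Ideal.Quotient.mk C) = x'.asIdeal := by
    rw [← hx']
    exact Ideal.map_comap_of_surjective _ hsurj _
  have hbdd' : BoundedTrdeg k ((A ⊗[k] B) ⧸ C) :=
    hbdd.of_surjective (Ideal.Quotient.mkₐ k C) hsurj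
  rw [hmap, idealHt_asIdeal]
  apply le_antisymm
  · let f := Ideal.Quotient.mkₐ k (comapLeft P).asIdeal
    let g := Ideal.Quotient.mkₐ k (comapRight P).asIdeal
    let ρ := Algebra.TensorProduct.map f g
    have hf : Function.Surjective f := Ideal.Quotient.mk_surjective
    have hg : Function.Surjective g := Ideal.Quotient.mk_surjective
    have hρ : Function.Surjective ρ := tensorProduct_map_surjective hf hg
    have hker : RingHom.ker ρ = C := by
      rw [Algebra.TensorProduct.map_ker f g hf hg, show RingHom.ker f = _ from Ideal.mk_ker,
        show RingHom.ker g = _ from Ideal.mk_ker]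
      rfl
    have hfbot : PrimeSpectrum.comap f.toRingHom ⊥ = comapLeft P :=
      PrimeSpectrum.ext Ideal.mk_ker
    have hgbot : PrimeSpectrum.comap g.toRingHom ⊥ = comapRight P :=
      PrimeSpectrum.ext Ideal.mk_ker
    obtain ⟨x, hx⟩ := exists_comap_eq_of_ker_le ρ.toRingHom hρ P (hker.trans_le hCP)
    obtain ⟨Q, hCQ, hQ⟩ := exists_height_eq_idealHt hCP
    obtain ⟨w, rfl⟩ := exists_comap_eq_of_ker_le ρ.toRingHom hρ Q (hker.trans_le hCQ)
    obtain ⟨z, hzw, hl, hr⟩ := exists_le_comapLeft_eq_bot w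
    have hl' := (comapLeft_comap_map f g z).trans
      ((congrArg (PrimeSpectrum.comap f.toRingHom) hl).trans hfbot)
    have hr' := (comapRight_comap_map f g z).trans
      ((congrArg (PrimeSpectrum.comap g.toRingHom) hr).trans hgbot)
    have hlx : comapLeft x = ⊥ := PrimeSpectrum.comap_injective_of_surjective f.toRingHom hf
      (by rw [hfbot, ← comapLeft_comap_map f g, hx])
    have hrx : comapRight x = ⊥ := PrimeSpectrum.comap_injective_of_surjective g.toRingHom hg
      (by rw [hgbot, ← comapRight_comap_map f g, hx])
    have h1 := h P (PrimeSpectrum.comap ρ.toRingHom z) hl'.symm hr'.symm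
    have h2 := eTrdeg_add_le_heightAddTrdeg
      ((BoundedTrdeg.of_eTrdeg_ne_top hA).ne_top (comapLeft P))
      ((BoundedTrdeg.of_eTrdeg_ne_top hB).ne_top (comapRight P)) x hlx hrx
    have h3 : Order.height (PrimeSpectrum.comap ρ.toRingHom z) ≤ idealHt C :=
      hQ ▸ Order.height_mono (Ideal.comap_mono hzw)
    have h4 := trdegAt_le_add (PrimeSpectrum.comap ρ.toRingHom z)
    rw [hl', hr'] at h4
    have h5 : trdegAt k x = trdegAt k P :=
      (trdegAt_comap_of_surjective ρ hρ x).symm.trans (congrArg (trdegAt k) hx)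
    let l := Ideal.Quotient.lift C ρ.toRingHom fun a ha => hker.ge ha
    have hl : Function.Surjective l := Ideal.Quotient.lift_surjective_of_surjective _ _ hρ
    have hlx : PrimeSpectrum.comap l x = x' := by
      refine PrimeSpectrum.comap_injective_of_surjective _ hsurj (Eq.trans ?_ (hx.trans hx'.symm))
      ext a
      rfl
    have h6 := Order.height_le_height_apply_of_strictMono _ (strictMono_comap_of_surjective l hl) x
    rw [hlx] at h6
    refine (ENat.add_le_add_iff_right (hbdd.ne_top P)).1 (h1.trans ((add_le_add h3 h4).trans ?_))
    rw [add_assoc]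
    refine add_le_add_right (h2.trans ?_) _
    exact add_le_add h6 h5.le
  · have h1 := idealHt_add_height_le (Ideal.Quotient.mk C) hsurj x' (hbdd'.height_ne_top x')
    rwa [Ideal.mk_ker, hx'] at h1

theorem isGAFDomain_of_heightAddTrdeg_le {k A : Type} [Field k] [CommRing A] [IsDomain A]
    [Algebra k A] (hA : eTrdeg k A ≠ ⊤)
    (h : ∀ (B : Type) [CommRing B] [Algebra k B], BoundedTrdeg k B →
      ∀ P Q : PrimeSpectrum (A ⊗[k] B), comapLeft P = comapLeft Q →
        comapRight P = comapRight Q → heightAddTrdeg k P ≤ heightAddTrdeg k Q) :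
    IsGAFDomain k A := by
  rintro B _ _ hB P hP _ rfl _ rfl
  exact (idealHt_asIdeal ⟨P, hP⟩).trans
    (height_eq_idealHt_add hA hB (h B (.of_eTrdeg_ne_top hB)) ⟨P, hP⟩)

end Criterion

section CommonExtension

theorem exists_algHom_algebraicClosure {D K F : Type u} [CommRing D] [IsDomain D] [Field K]
    [Field F] [Algebra D K] [Algebra D F] [FaithfulSMul D K] [FaithfulSMul D F]
    (hle : Algebra.trdeg D K ≤ Algebra.trdeg D F) :
    Nonempty (K →ₐ[D] AlgebraicClosure F) := by
  obtain ⟨Z, hZ⟩ := exists_isTranscendenceBasis D K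
  obtain ⟨W, hW⟩ := exists_isTranscendenceBasis D F
  rw [← hZ.cardinalMk_eq_trdeg, ← hW.cardinalMk_eq_trdeg] at hle
  obtain ⟨e⟩ := hle
  let f : F →ₐ[D] AlgebraicClosure F := IsScalarTower.toAlgHom D F (AlgebraicClosure F)
  have hind : AlgebraicIndependent D (f ∘ ((↑) : W → F) ∘ e) :=
    AlgebraicIndependent.map' (hW.1.comp e e.injective) f.injective
  let R := Algebra.adjoin D (Set.range ((↑) : Z → K))
  let φ : R →ₐ[D] AlgebraicClosure F :=
    (MvPolynomial.aeval (f ∘ ((↑) : W → F) ∘ e)).comp hZ.1.aevalEquiv.symm.toAlgHom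
  have hφ : Function.Injective φ :=
    (show Function.Injective (MvPolynomial.aeval (R := D) (f ∘ ((↑) : W → F) ∘ e)) from hind).comp
      hZ.1.aevalEquiv.symm.injective
  let : Algebra R (AlgebraicClosure F) := φ.toAlgebra
  have : IsScalarTower D R (AlgebraicClosure F) := .of_algHom φ
  have : Algebra.IsAlgebraic R K := hZ.isAlgebraic
  have : FaithfulSMul R (AlgebraicClosure F) := (faithfulSMul_iff_algebraMap_injective _ _).2 hφ
  exact ⟨(IsAlgClosed.lift : K →ₐ[R] AlgebraicClosure F).restrictScalars D⟩

variable {k : Type u} [Field k]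

theorem eTrdeg_algebraicClosure (F : Type u) [Field F] [Algebra k F] :
    eTrdeg k (AlgebraicClosure F) = eTrdeg k F := by
  rw [← eTrdeg_add_eq k F (AlgebraicClosure F), eTrdeg_eq_toENat_trdeg F,
    trdeg_eq_zero_iff.2 inferInstance]
  simp

theorem exists_common_extension {D K F : Type u} [CommRing D] [IsDomain D] [Field K] [Field F]
    [Algebra k D] [Algebra k K] [Algebra k F] (i : D →ₐ[k] K) (j : D →ₐ[k] F)
    (hi : Function.Injective i) (hj : Function.Injective j) :
    ∃ (Ω : Type u) (_ : Field Ω) (_ : Algebra k Ω) (a : K →ₐ[k] Ω) (b : F →ₐ[k] Ω),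
      a.comp i = b.comp j ∧ eTrdeg k Ω ≤ max (eTrdeg k K) (eTrdeg k F) := by
  let : Algebra D K := i.toAlgebra
  let : Algebra D F := j.toAlgebra
  have : IsScalarTower k D K := .of_algHom i
  have : IsScalarTower k D F := .of_algHom j
  have : FaithfulSMul D K := (faithfulSMul_iff_algebraMap_injective _ _).2 hi
  have : FaithfulSMul D F := (faithfulSMul_iff_algebraMap_injective _ _).2 hj
  rcases le_total (Algebra.trdeg D K) (Algebra.trdeg D F) with hle | hle
  · obtain ⟨a⟩ := exists_algHom_algebraicClosure hle
    exact ⟨AlgebraicClosure F, inferInstance, inferInstance, a.restrictScalars k,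
      IsScalarTower.toAlgHom k F (AlgebraicClosure F), AlgHom.ext a.commutes,
      (eTrdeg_algebraicClosure F).trans_le (le_max_right _ _)⟩
  · obtain ⟨b⟩ := exists_algHom_algebraicClosure hle
    exact ⟨AlgebraicClosure K, inferInstance, inferInstance,
      IsScalarTower.toAlgHom k K (AlgebraicClosure K), b.restrictScalars k,
      AlgHom.ext fun d => (b.commutes d).symm,
      (eTrdeg_algebraicClosure K).trans_le (le_max_left _ _)⟩

end CommonExtension

section Conductor

variable {R S : Type*} [CommRing R] [CommRing S] {ι : R →+* S} {I : Ideal S}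

theorem le_of_comap_le (hI : ∀ x ∈ I, x ∈ ι.range) {P Q : PrimeSpectrum S}
    (hQ : ¬ I ≤ Q.asIdeal) (h : PrimeSpectrum.comap ι P ≤ PrimeSpectrum.comap ι Q) : P ≤ Q := by
  obtain ⟨i, hi, hiQ⟩ := SetLike.not_le_iff_exists.1 hQ
  intro x hx
  obtain ⟨r, hr⟩ := hI (x * i) (I.mul_mem_left x hi)
  have hrQ : ι r ∈ Q.asIdeal := h (show ι r ∈ P.asIdeal from hr ▸ P.asIdeal.mul_mem_right i hx)
  exact (Q.isPrime.mem_or_mem (hr ▸ hrQ)).resolve_right hiQ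

theorem exists_comap_eq_of_not_le (hι : Function.Injective ι) (hI : ∀ x ∈ I, x ∈ ι.range)
    (P : PrimeSpectrum R) (hP : ¬ I.comap ι ≤ P.asIdeal) :
    ∃ Q : PrimeSpectrum S, ¬ I ≤ Q.asIdeal ∧ PrimeSpectrum.comap ι Q = P := by
  suffices h : P ∈ Set.range (PrimeSpectrum.comap ι) by
    obtain ⟨Q, rfl⟩ := h
    exact ⟨Q, fun h => hP (Ideal.comap_mono h), rfl⟩
  rw [PrimeSpectrum.mem_range_comap_iff]
  refine le_antisymm (fun r hr => ?_) Ideal.le_comap_map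
  obtain ⟨i, hi, hiP⟩ := SetLike.not_le_iff_exists.1 hP
  have key : ∀ x ∈ P.asIdeal.map ι, ∀ s ∈ I, ∃ p ∈ P.asIdeal, ι p = x * s := by
    intro x hx
    refine Submodule.span_induction (p := fun x _ => ∀ s ∈ I, ∃ p ∈ P.asIdeal, ι p = x * s)
      ?_ ?_ ?_ ?_ hx
    · rintro _ ⟨p, hp, rfl⟩ s hs
      obtain ⟨r, rfl⟩ := hI s hs
      exact ⟨p * r, P.asIdeal.mul_mem_right r hp, map_mul ι p r⟩
    · exact fun s _ => ⟨0, zero_mem _, by simp⟩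
    · intro x y _ _ hx hy s hs
      obtain ⟨p, hp, h1⟩ := hx s hs
      obtain ⟨q, hq, h2⟩ := hy s hs
      exact ⟨p + q, add_mem hp hq, by rw [map_add, h1, h2, add_mul]⟩
    · intro a x _ hx s hs
      obtain ⟨p, hp, h1⟩ := hx (a * s) (I.mul_mem_left a hs)
      exact ⟨p, hp, by rw [h1, smul_eq_mul]; ring⟩
  obtain ⟨p, hp, hpr⟩ := key (ι r) hr (ι i) hi
  rw [← map_mul] at hpr
  exact (P.isPrime.mem_or_mem (hι hpr ▸ hp)).resolve_right hiP

theorem height_comap_eq_of_not_le [WellFoundedLT (PrimeSpectrum S)] (hι : Function.Injective ι)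
    (hI : ∀ x ∈ I, x ∈ ι.range) (Q : PrimeSpectrum S) (hQ : ¬ I ≤ Q.asIdeal) :
    Order.height (PrimeSpectrum.comap ι Q) = Order.height Q := by
  induction Q using WellFoundedLT.induction with
  | ind Q ih =>
  refine le_antisymm (height_le_of_forall_lt fun P hP => ?_) (height_le_of_forall_lt fun P hP => ?_)
  · obtain ⟨P, hIP, rfl⟩ := exists_comap_eq_of_not_le hι hI P fun h => hQ fun x hx => by
      obtain ⟨r, rfl⟩ := hI x hx
      exact hP.le (h hx)
    have hlt : P < Q := (le_of_comap_le hI hQ hP.le).lt_of_ne (by rintro rfl; exact hP.ne rfl)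
    rw [ih P hlt hIP]
    exact Order.height_add_one_le hlt
  · have hIP : ¬ I ≤ P.asIdeal := fun h => hQ (h.trans hP.le)
    rw [← ih P hP hIP]
    refine Order.height_add_one_le (lt_of_le_not_ge (Ideal.comap_mono hP.le) fun h => ?_)
    exact hP.not_ge (le_of_comap_le hI hIP h)

theorem exists_comap_le_of_comap_le (hI : ∀ x ∈ I, x ∈ ι.range) (J : Ideal S)
    (P : PrimeSpectrum R) (hIP : I.comap ι ≤ P.asIdeal) (hJP : J.comap ι ≤ P.asIdeal) :
    ∃ Q : PrimeSpectrum S, I ≤ Q.asIdeal ∧ J ≤ Q.asIdeal ∧ PrimeSpectrum.comap ι Q ≤ P := by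
  have hdisj : Disjoint ((I ⊔ J : Ideal S) : Set S)
      (P.asIdeal.primeCompl.map (ι : R →* S) : Submonoid S) := by
    rw [Set.disjoint_left]
    rintro _ hx ⟨r, hr, rfl⟩
    obtain ⟨i, hi, j, hj, hij⟩ := Submodule.mem_sup.1 hx
    obtain ⟨r', rfl⟩ := hI i hi
    have hij' : ι r' + j = ι r := hij
    have h1 : r - r' ∈ P.asIdeal := hJP (by
      rw [Ideal.mem_comap, map_sub, sub_eq_of_eq_add' hij'.symm]
      exact hj)
    exact hr (by simpa using add_mem h1 (hIP hi))
  obtain ⟨Q, hQ, hle, hdisj'⟩ := Ideal.exists_le_prime_disjoint _ _ hdisj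
  refine ⟨⟨Q, hQ⟩, le_sup_left.trans hle, le_sup_right.trans hle, fun r hr => ?_⟩
  by_contra h
  exact Set.disjoint_left.1 hdisj' hr ⟨r, h, rfl⟩

theorem trdegAt_comap_eq_of_not_le {k R S : Type u} [Field k] [CommRing R] [CommRing S]
    [Algebra k R] [Algebra k S] {ι : R →ₐ[k] S} {I : Ideal S} (hI : ∀ x ∈ I, x ∈ ι.range)
    (Q : PrimeSpectrum S) (hQ : ¬ I ≤ Q.asIdeal) :
    trdegAt k (PrimeSpectrum.comap ι.toRingHom Q) = trdegAt k Q := by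
  obtain ⟨i, hi, hiQ⟩ := SetLike.not_le_iff_exists.1 hQ
  obtain ⟨c, rfl⟩ := hI i hi
  let P := PrimeSpectrum.comap ι.toRingHom Q
  let f : R ⧸ P.asIdeal →ₐ[k] S ⧸ Q.asIdeal := Ideal.quotientMapₐ Q.asIdeal ι le_rfl
  have hf : Function.Injective f := Ideal.quotientMap_injective' (H := le_rfl) le_rfl
  let : Algebra (R ⧸ P.asIdeal) (S ⧸ Q.asIdeal) := f.toAlgebra
  have : IsScalarTower k (R ⧸ P.asIdeal) (S ⧸ Q.asIdeal) := .of_algHom f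
  have : FaithfulSMul (R ⧸ P.asIdeal) (S ⧸ Q.asIdeal) :=
    (faithfulSMul_iff_algebraMap_injective _ _).2 hf
  have halg : Algebra.IsAlgebraic (R ⧸ P.asIdeal) (S ⧸ Q.asIdeal) := ⟨fun x => by
    obtain ⟨x, rfl⟩ := Ideal.Quotient.mk_surjective x
    obtain ⟨r, hr⟩ := hI (ι c * x) (I.mul_mem_right x hi)
    have hc : (Ideal.Quotient.mk P.asIdeal c) ∈ nonZeroDivisors (R ⧸ P.asIdeal) :=
      mem_nonZeroDivisors_of_ne_zero fun h => hiQ (show c ∈ P.asIdeal from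
        Ideal.Quotient.eq_zero_iff_mem.1 h)
    refine IsAlgebraic.of_smul hc ?_
    convert isAlgebraic_algebraMap (A := S ⧸ Q.asIdeal) (Ideal.Quotient.mk P.asIdeal r) using 1
    exact (congrArg (Ideal.Quotient.mk Q.asIdeal) hr).symm⟩
  rw [trdegAt, trdegAt, ← eTrdeg_add_eq k (R ⧸ P.asIdeal) (S ⧸ Q.asIdeal),
    eTrdeg_eq_toENat_trdeg (R ⧸ P.asIdeal), trdeg_eq_zero_iff.2 halg]
  simp [P]

end Conductor

section TensorConductor

variable {k : Type u} [Field k] {A T B : Type u} [CommRing A] [CommRing T] [CommRing B]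
  [Algebra k A] [Algebra k T] [Algebra k B]

/-- The extension of an ideal `M` of `T` to `T ⊗[k] B`. -/
abbrev extendLeft (B : Type u) [CommRing B] [Algebra k B] (M : Ideal T) : Ideal (T ⊗[k] B) :=
  M.map (Algebra.TensorProduct.includeLeft : T →ₐ[k] T ⊗[k] B).toRingHom

theorem extendLeft_le_iff {M : Ideal T} {P : PrimeSpectrum (T ⊗[k] B)} :
    extendLeft B M ≤ P.asIdeal ↔ M ≤ (comapLeft P).asIdeal :=
  Ideal.map_le_iff_le_comap

variable {ψ : A →ₐ[k] T}

theorem baseMap_injective (hψ : Function.Injective ψ) : Function.Injective (baseMap B ψ) :=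
  Module.Flat.rTensor_preserves_injective_linearMap (M := B) ψ.toLinearMap hψ

theorem exists_mem_extendLeft_comap {M : Ideal T} (hM : ∀ m ∈ M, m ∈ ψ.range) (x : T ⊗[k] B)
    (hx : x ∈ extendLeft B M) :
    ∃ y ∈ extendLeft B (M.comap ψ.toRingHom), baseMap B ψ y = x := by
  suffices h : ∀ s : T ⊗[k] B, ∃ y ∈ extendLeft B (M.comap ψ.toRingHom),
      baseMap B ψ y = s * x by simpa using h 1
  refine Submodule.span_induction
    (p := fun x _ => ∀ s : T ⊗[k] B, ∃ y ∈ extendLeft B (M.comap ψ.toRingHom),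
      baseMap B ψ y = s * x) ?_ ?_ ?_ ?_ hx
  · rintro _ ⟨m, hm, rfl⟩ s
    induction s with
    | zero => exact ⟨0, zero_mem _, by simp⟩
    | add s t hs ht =>
      obtain ⟨y, hy, h1⟩ := hs
      obtain ⟨z, hz, h2⟩ := ht
      exact ⟨y + z, add_mem hy hz, by rw [map_add, h1, h2, add_mul]⟩
    | tmul t b =>
      obtain ⟨a, ha⟩ := hM (t * m) (M.mul_mem_left t hm)
      have ha' : ψ a = t * m := ha
      have haM : a ∈ M.comap ψ.toRingHom := show ψ a ∈ M from ha' ▸ M.mul_mem_left t hm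
      refine ⟨a ⊗ₜ b, ?_, ?_⟩
      · have := Ideal.mul_mem_left (extendLeft B (M.comap ψ.toRingHom)) ((1 : A) ⊗ₜ[k] b)
          (Ideal.mem_map_of_mem _ haM)
        simpa using this
      · rw [baseMap_tmul, ha']
        change _ = t ⊗ₜ[k] b * m ⊗ₜ[k] 1
        simp
  · exact fun s => ⟨0, zero_mem _, by simp⟩
  · intro x y _ _ hx hy s
    obtain ⟨x', hx', h1⟩ := hx s
    obtain ⟨y', hy', h2⟩ := hy s
    exact ⟨x' + y', add_mem hx' hy', by rw [map_add, h1, h2, mul_add]⟩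
  · intro a x _ hx s
    obtain ⟨y, hy, h⟩ := hx (s * a)
    exact ⟨y, hy, by rw [h, smul_eq_mul, mul_assoc]⟩

theorem mem_range_of_mem_extendLeft {M : Ideal T} (hM : ∀ m ∈ M, m ∈ ψ.range) (x : T ⊗[k] B)
    (hx : x ∈ extendLeft B M) : x ∈ (baseMap B ψ).range :=
  let ⟨y, _, h⟩ := exists_mem_extendLeft_comap hM x hx
  ⟨y, h⟩

theorem comap_extendLeft_le_iff {M : Ideal T} (hψ : Function.Injective ψ)
    (hM : ∀ m ∈ M, m ∈ ψ.range) {P : PrimeSpectrum (A ⊗[k] B)} :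
    (extendLeft B M).comap (baseMap B ψ).toRingHom ≤ P.asIdeal ↔
      M.comap ψ.toRingHom ≤ (comapLeft P).asIdeal := by
  refine ⟨fun h a ha => h ?_, fun h x hx => ?_⟩
  · change baseMap B ψ (a ⊗ₜ 1) ∈ extendLeft B M
    rw [baseMap_tmul]
    exact Ideal.mem_map_of_mem _ ha
  · obtain ⟨y, hy, hxy⟩ := exists_mem_extendLeft_comap hM _ hx
    rw [← baseMap_injective hψ hxy]
    exact extendLeft_le_iff.2 h hy

/-- A prime of `A ⊗[k] B` not containing the conductor lifts to `T ⊗[k] B`, with the same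
invariants. -/
theorem exists_comap_baseMap_eq {M : Ideal T} (hψ : Function.Injective ψ)
    (hM : ∀ m ∈ M, m ∈ ψ.range) (hbdd : BoundedTrdeg k (T ⊗[k] B)) (P : PrimeSpectrum (A ⊗[k] B))
    (hP : ¬ M.comap ψ.toRingHom ≤ (comapLeft P).asIdeal) :
    ∃ Q : PrimeSpectrum (T ⊗[k] B), PrimeSpectrum.comap (baseMap B ψ).toRingHom Q = P ∧
      ¬ extendLeft B M ≤ Q.asIdeal ∧ Order.height Q = Order.height P ∧
      trdegAt k Q = trdegAt k P := by
  have := hbdd.wellFoundedLT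
  have hI := mem_range_of_mem_extendLeft (B := B) hM
  rw [← comap_extendLeft_le_iff hψ hM] at hP
  obtain ⟨Q, hQ, rfl⟩ := exists_comap_eq_of_not_le (baseMap_injective hψ) hI P hP
  exact ⟨Q, rfl, hQ, (height_comap_eq_of_not_le (baseMap_injective hψ) hI Q hQ).symm,
    (trdegAt_comap_eq_of_not_le hI Q hQ).symm⟩

/-- The basic comparison of heights: a prime of `A ⊗[k] B` containing the conductor dominates a
prime `Q` of `T ⊗[k] B` containing the conductor, through a chain inside `D ⊗[k] (B ⧸ (Q ∩ B))`. -/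
theorem exists_height_add_le {D : Type u} [CommRing D] [Algebra k D] {π : A →ₐ[k] D}
    (hπ : Function.Surjective π) {M : Ideal T} (hψ : Function.Injective ψ)
    (hM : ∀ m ∈ M, m ∈ ψ.range) (hker : RingHom.ker π = M.comap ψ.toRingHom)
    (hbdd : BoundedTrdeg k (T ⊗[k] B)) (P : PrimeSpectrum (A ⊗[k] B))
    (hPtop : Order.height P ≠ ⊤) (hP : RingHom.ker π ≤ (comapLeft P).asIdeal) :
    ∃ Q : PrimeSpectrum (T ⊗[k] B), extendLeft B M ≤ Q.asIdeal ∧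
      ∃ y x : PrimeSpectrum (D ⊗[k] (B ⧸ (comapRight Q).asIdeal)), y ≤ x ∧
        PrimeSpectrum.comap (Algebra.TensorProduct.map π
          (Ideal.Quotient.mkₐ k (comapRight Q).asIdeal)).toRingHom x = P ∧
        PrimeSpectrum.comap (Algebra.TensorProduct.map π
          (Ideal.Quotient.mkₐ k (comapRight Q).asIdeal)).toRingHom y =
            PrimeSpectrum.comap (baseMap B ψ).toRingHom Q ∧
        Order.height P + Order.height y ≤ Order.height Q + Order.height x := by
  have hI := mem_range_of_mem_extendLeft (B := B) hM
  have lift (J : Ideal (T ⊗[k] B)) (P : PrimeSpectrum (A ⊗[k] B))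
      (hP : RingHom.ker π ≤ (comapLeft P).asIdeal)
      (hJ : J.comap (baseMap B ψ).toRingHom ≤ P.asIdeal) :
      ∃ Q : PrimeSpectrum (T ⊗[k] B), extendLeft B M ≤ Q.asIdeal ∧ J ≤ Q.asIdeal ∧
      ∃ y x : PrimeSpectrum (D ⊗[k] (B ⧸ (comapRight Q).asIdeal)), y ≤ x ∧
        PrimeSpectrum.comap (Algebra.TensorProduct.map π
          (Ideal.Quotient.mkₐ k (comapRight Q).asIdeal)).toRingHom x = P ∧
        PrimeSpectrum.comap (Algebra.TensorProduct.map π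
          (Ideal.Quotient.mkₐ k (comapRight Q).asIdeal)).toRingHom y =
            PrimeSpectrum.comap (baseMap B ψ).toRingHom Q := by
    rw [hker] at hP
    obtain ⟨Q, hIQ, hJQ, hQP⟩ := exists_comap_le_of_comap_le hI J P
      ((comap_extendLeft_le_iff hψ hM).2 hP) hJ
    have hker' : RingHom.ker (Ideal.Quotient.mkₐ k (comapRight Q).asIdeal) =
      (comapRight Q).asIdeal := Ideal.mk_ker
    have hr : comapRight Q ≤ comapRight P := by
      rw [← comapRight_comap_baseMap ψ]
      exact Ideal.comap_mono hQP
    obtain ⟨x, hx⟩ := exists_comap_map_eq hπ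
      (Ideal.Quotient.mkₐ_surjective k (comapRight Q).asIdeal)
      P (hker ▸ hP) (hker'.trans_le hr)
    obtain ⟨y, hy⟩ := exists_comap_map_eq hπ
      (Ideal.Quotient.mkₐ_surjective k (comapRight Q).asIdeal)
      (PrimeSpectrum.comap (baseMap B ψ).toRingHom Q)
      (hker.trans_le ((comap_extendLeft_le_iff hψ hM).1 (Ideal.comap_mono hIQ)))
      (hker'.trans_le (by rw [comapRight_comap_baseMap]))
    refine ⟨Q, hIQ, hJQ, y, x, ?_, hx, hy⟩
    rw [← comap_le_comap_iff_of_surjective _ (tensorProduct_map_surjective hπ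
      (Ideal.Quotient.mkₐ_surjective k (comapRight Q).asIdeal)), hx, hy]
    exact hQP
  obtain ⟨n, hn⟩ := ENat.ne_top_iff_exists.1 hPtop
  clear hPtop
  induction n generalizing P with
  | zero =>
    obtain ⟨Q, hIQ, -, y, x, hyx, hx, hy⟩ := lift ⊥ P hP (by
      intro z hz
      rw [baseMap_injective hψ ((show baseMap B ψ z = 0 from hz).trans (map_zero _).symm)]
      exact zero_mem _)
    refine ⟨Q, hIQ, y, x, hyx, hx, hy, ?_⟩
    rw [← hn]
    simpa using le_add_left (Order.height_mono hyx)
  | succ n ih =>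
    obtain ⟨-, ⟨P', hlt, hP'⟩, -⟩ := Order.height_eq_coe_add_one_iff.1
      (hn.symm.trans (Nat.cast_succ n))
    by_cases hPk : RingHom.ker π ≤ (comapLeft P').asIdeal
    · obtain ⟨Q, hIQ, y, x', hyx, hx', hy, hle⟩ := ih P' hPk hP'.symm
      have hsurj := tensorProduct_map_surjective hπ
        (Ideal.Quotient.mkₐ_surjective k (comapRight Q).asIdeal)
      obtain ⟨x, hx⟩ := exists_comap_eq_of_ker_le _ hsurj P
        ((Ideal.comap_mono bot_le).trans (hx'.trans_le hlt.le))
      have hxx : x' < x := lt_of_le_of_ne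
        ((comap_le_comap_iff_of_surjective _ hsurj).1 (by rw [hx, hx']; exact hlt.le))
        (by rintro rfl; exact hlt.ne (hx'.symm.trans hx))
      refine ⟨Q, hIQ, y, x, hyx.trans hxx.le, hx, hy, ?_⟩
      calc Order.height P + Order.height y = Order.height P' + Order.height y + 1 := by
            rw [← hn, hP', Nat.cast_succ]; ring
        _ ≤ Order.height Q + Order.height x' + 1 := by gcongr
        _ ≤ Order.height Q + Order.height x := by
            rw [add_assoc]; gcongr; exact Order.height_add_one_le hxx
    · obtain ⟨Q', rfl, hQI, hQh, -⟩ := exists_comap_baseMap_eq hψ hM hbdd P' (hker ▸ hPk)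
      obtain ⟨Q, hIQ, hQQ, y, x, hyx, hx, hy⟩ := lift Q'.asIdeal P hP hlt.le
      refine ⟨Q, hIQ, y, x, hyx, hx, hy, add_le_add ?_ (Order.height_mono hyx)⟩
      rw [← hn, Nat.cast_succ, ← hP', ← hQh]
      exact Order.height_add_one_le (lt_of_le_of_ne (b := Q) hQQ (by rintro rfl; exact hQI hIQ))

end TensorConductor

section Pullback

variable {k : Type u} [Field k] {A T B : Type u} [CommRing A] [CommRing T] [CommRing B]
  [Algebra k A] [Algebra k T] [Algebra k B] {ψ : A →ₐ[k] T}

theorem eTrdeg_fractionRing (R : Type u) [CommRing R] [IsDomain R] [Algebra k R] :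
    eTrdeg k (FractionRing R) = eTrdeg k R := by
  have : Algebra.IsAlgebraic R (FractionRing R) := IsFractionRing.comap_isAlgebraic_iff.2
    (inferInstance : Algebra.IsAlgebraic (FractionRing R) (FractionRing R))
  rw [← eTrdeg_add_eq k R (FractionRing R), eTrdeg_eq_toENat_trdeg R, trdeg_eq_zero_iff.2 this]
  simp

/-- A prime of `A ⊗[k] B` lying over the contraction of a prime `m` of `T` lifts to a prime of
`T ⊗[k] B` over `m` with residue ring of the least possible transcendence degree. -/
theorem exists_comap_baseMap_eq_of_comapLeft (z : PrimeSpectrum (A ⊗[k] B)) (m : PrimeSpectrum T)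
    (hz : comapLeft z = PrimeSpectrum.comap ψ.toRingHom m) :
    ∃ Q : PrimeSpectrum (T ⊗[k] B), comapLeft Q = m ∧
      PrimeSpectrum.comap (baseMap B ψ).toRingHom Q = z ∧
      trdegAt k Q ≤ max (trdegAt k m) (trdegAt k z) := by
  let p := PrimeSpectrum.comap ψ.toRingHom m
  let K := FractionRing (T ⧸ m.asIdeal)
  let F := FractionRing ((A ⊗[k] B) ⧸ z.asIdeal)
  let cK : T ⧸ m.asIdeal →ₐ[k] K := Algebra.algHom k _ _
  let cF : (A ⊗[k] B) ⧸ z.asIdeal →ₐ[k] F := Algebra.algHom k _ _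
  have hcK : Function.Injective cK := IsFractionRing.injective _ _
  have hcF : Function.Injective cF := IsFractionRing.injective _ _
  let i : A ⧸ p.asIdeal →ₐ[k] T ⧸ m.asIdeal := Ideal.quotientMapₐ m.asIdeal ψ le_rfl
  let j : A ⧸ p.asIdeal →ₐ[k] (A ⊗[k] B) ⧸ z.asIdeal :=
    Ideal.quotientMapₐ z.asIdeal Algebra.TensorProduct.includeLeft hz.ge
  obtain ⟨Ω, _, _, a, b, hab, hΩ⟩ := exists_common_extension (cK.comp i) (cF.comp j)
    (hcK.comp (Ideal.quotientMap_injective' (H := le_rfl) le_rfl))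
    (hcF.comp (Ideal.quotientMap_injective' (H := hz.ge) hz.le))
  let θ₁ : T →ₐ[k] Ω := (a.comp cK).comp (Ideal.Quotient.mkₐ k m.asIdeal)
  let θ₂ : A ⊗[k] B →ₐ[k] Ω := (b.comp cF).comp (Ideal.Quotient.mkₐ k z.asIdeal)
  have hθ₁ (t : T) : θ₁ t = 0 ↔ t ∈ m.asIdeal :=
    (map_eq_zero_iff (a.comp cK) (a.injective.comp hcK)).trans Ideal.Quotient.eq_zero_iff_mem
  have hθ₂ (x : A ⊗[k] B) : θ₂ x = 0 ↔ x ∈ z.asIdeal :=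
    (map_eq_zero_iff (b.comp cF) (b.injective.comp hcF)).trans Ideal.Quotient.eq_zero_iff_mem
  let θ : T ⊗[k] B →ₐ[k] Ω := Algebra.TensorProduct.productMap θ₁
    (θ₂.comp Algebra.TensorProduct.includeRight)
  have hθ : θ.comp (baseMap B ψ) = θ₂ := by
    refine Algebra.TensorProduct.ext' fun x y => ?_
    have hx : θ₁ (ψ x) = θ₂ (x ⊗ₜ 1) := DFunLike.congr_fun hab (Ideal.Quotient.mk p.asIdeal x)
    rw [AlgHom.comp_apply, baseMap_tmul, Algebra.TensorProduct.productMap_apply_tmul, hx]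
    change θ₂ _ * θ₂ (1 ⊗ₜ y) = _
    rw [← map_mul]
    simp
  refine ⟨⟨RingHom.ker θ, RingHom.ker_isPrime θ⟩, ?_, ?_, ?_⟩
  · ext t
    change θ (t ⊗ₜ 1) = 0 ↔ _
    rw [← hθ₁, Algebra.TensorProduct.productMap_apply_tmul, map_one, mul_one]
  · ext x
    change θ (baseMap B ψ x) = 0 ↔ _
    rw [← hθ₂, ← hθ, AlgHom.comp_apply]
  · rw [eTrdeg_fractionRing, eTrdeg_fractionRing] at hΩ
    exact (eTrdeg_le_of_injective (Ideal.kerLiftAlg θ) (Ideal.kerLiftAlg_injective θ)).trans hΩ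

variable [IsDomain T]

/-- If `T` is an AF-domain and `M ≠ ⊥`, then contraction along the conductor does not decrease
the heights of primes of `T ⊗[k] B` over `M`. -/
theorem height_le_height_comap_baseMap (hT : eTrdeg k T ≠ ⊤)
    (hAF : ∀ p : PrimeSpectrum T, heightAddTrdeg k p = eTrdeg k T) (hB : BoundedTrdeg k B)
    (m : PrimeSpectrum T) (hm : m ≠ ⊥) (hψ : Function.Injective ψ)
    (hM : ∀ x ∈ m.asIdeal, x ∈ ψ.range) (Q : PrimeSpectrum (T ⊗[k] B)) (hQ : comapLeft Q = m) :
    Order.height Q ≤ Order.height (PrimeSpectrum.comap (baseMap B ψ).toRingHom Q) := by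
  have hbT := BoundedTrdeg.of_eTrdeg_ne_top hT
  have hbdd := hbT.tensor hB
  have := hbdd.wellFoundedLT
  obtain ⟨n, hn⟩ := ENat.ne_top_iff_exists.1 (hbT.height_ne_top m)
  obtain _ | n := n
  · exact absurd (Order.height_eq_zero.1 hn.symm).eq_bot hm
  obtain ⟨-, ⟨p, hlt, hp⟩, -⟩ := Order.height_eq_coe_add_one_iff.1
    (hn.symm.trans (Nat.cast_succ n))
  obtain ⟨Q', hQ', hl, hr, hle⟩ := exists_le_comapLeft_eq_trdegAt_le Q (hlt.le.trans hQ.ge)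
  have hI : ¬ extendLeft B m.asIdeal ≤ Q'.asIdeal := by
    rw [extendLeft_le_iff, hl]
    exact hlt.not_ge
  have hlt' : PrimeSpectrum.comap (baseMap B ψ).toRingHom Q' <
      PrimeSpectrum.comap (baseMap B ψ).toRingHom Q := by
    refine lt_of_le_not_ge (Ideal.comap_mono hQ') fun h => hI ?_
    have hQQ := le_of_comap_le (mem_range_of_mem_extendLeft hM) hI h
    exact (extendLeft_le_iff.2 hQ.ge).trans hQQ
  refine le_trans ?_ (Order.height_add_one_le hlt')
  rw [height_comap_eq_of_not_le (baseMap_injective hψ) (mem_range_of_mem_extendLeft hM) Q' hI]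
  have hfib : heightAddTrdeg k Q = heightAddTrdeg k Q' :=
    fibreConst_includeRight hT hAF hB Q Q' hr.symm
  have hpm : heightAddTrdeg k p = heightAddTrdeg k m := (hAF p).trans (hAF m).symm
  rw [hQ] at hle
  rw [heightAddTrdeg, heightAddTrdeg] at hfib hpm
  rw [hp, ← hn] at hpm
  obtain ⟨a, ha⟩ := ENat.ne_top_iff_exists.1 (hbdd.ne_top Q)
  obtain ⟨a', ha'⟩ := ENat.ne_top_iff_exists.1 (hbdd.ne_top Q')
  obtain ⟨b, hb⟩ := ENat.ne_top_iff_exists.1 (hbdd.height_ne_top Q)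
  obtain ⟨b', hb'⟩ := ENat.ne_top_iff_exists.1 (hbdd.height_ne_top Q')
  obtain ⟨c, hc⟩ := ENat.ne_top_iff_exists.1 (hbT.ne_top m)
  obtain ⟨c', hc'⟩ := ENat.ne_top_iff_exists.1 (hbT.ne_top p)
  rw [← ha, ← ha', ← hb, ← hb'] at hfib
  rw [← hc, ← hc'] at hpm
  rw [← ha, ← ha', ← hc, ← hc'] at hle
  rw [← hb, ← hb']
  norm_cast at hfib hpm hle ⊢
  omega

/-- The residue invariant of primes of `A ⊗[k] B` depends only on the contractions when `A` is
the pullback of an AF-domain `D ⊆ T ⧸ M` with `T` an AF-domain. -/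
theorem heightAddTrdeg_le_of_pullback {D : Type u} [CommRing D] [IsDomain D] [Algebra k D]
    {π : A →ₐ[k] D} (hπ : Function.Surjective π) (hT : eTrdeg k T ≠ ⊤)
    (hTAF : ∀ p : PrimeSpectrum T, heightAddTrdeg k p = eTrdeg k T)
    (hDAF : ∀ p : PrimeSpectrum D, heightAddTrdeg k p = eTrdeg k D)
    (hB : BoundedTrdeg k B) (m : PrimeSpectrum T) [hmax : m.asIdeal.IsMaximal]
    (hψ : Function.Injective ψ)
    (hM : ∀ x ∈ m.asIdeal, x ∈ ψ.range) (hker : RingHom.ker π = m.asIdeal.comap ψ.toRingHom)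
    (P P₂ : PrimeSpectrum (A ⊗[k] B)) (hl : comapLeft P = comapLeft P₂)
    (hr : comapRight P = comapRight P₂) : heightAddTrdeg k P ≤ heightAddTrdeg k P₂ := by
  have : IsDomain A := hψ.isDomain ψ.toRingHom
  have hA : eTrdeg k A ≠ ⊤ := ne_top_of_le_ne_top hT (eTrdeg_le_of_injective ψ hψ)
  have hD : eTrdeg k D ≠ ⊤ := ne_top_of_le_ne_top hA (eTrdeg_le_of_surjective π hπ)
  have hbA := (BoundedTrdeg.of_eTrdeg_ne_top hA).tensor hB
  have hbT := (BoundedTrdeg.of_eTrdeg_ne_top hT).tensor hB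
  by_cases hPk : RingHom.ker π ≤ (comapLeft P).asIdeal
  swap
  · obtain ⟨Q, hQ, -, hh, hd⟩ := exists_comap_baseMap_eq hψ hM hbT P (hker ▸ hPk)
    obtain ⟨Q₂, hQ₂, -, hh₂, hd₂⟩ := exists_comap_baseMap_eq hψ hM hbT P₂ (hker ▸ hl ▸ hPk)
    rw [heightAddTrdeg, heightAddTrdeg, ← hh, ← hd, ← hh₂, ← hd₂]
    refine (fibreConst_includeRight hT hTAF hB Q Q₂ ?_).le
    rwa [← hQ, ← hQ₂, comapRight_comap_baseMap, comapRight_comap_baseMap] at hr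
  by_cases hm : m = ⊥
  · subst hm
    have hinj : Function.Injective π := by
      refine (injective_iff_map_eq_zero π).2 fun a ha => ?_
      have : a ∈ (⊥ : PrimeSpectrum T).asIdeal.comap ψ.toRingHom := hker ▸ ha
      exact hψ ((show ψ a = 0 from this).trans (map_zero ψ).symm)
    let e : A ≃ₐ[k] D := AlgEquiv.ofBijective π ⟨hinj, hπ⟩
    refine (fibreConst_includeRight hA (fun p => ?_) hB P P₂ hr).le
    rw [eTrdeg_congr e, ← hDAF (PrimeSpectrum.comap e.symm.toAlgHom.toRingHom p),
      heightAddTrdeg_comap_equiv]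
  obtain ⟨Q, hIQ, yQ, yP, hyle, rfl, hyQ, h₁⟩ :=
    exists_height_add_le hπ hψ hM hker hbT P (hbA.height_ne_top P) hPk
  let q := comapRight Q
  let g := Ideal.Quotient.mkₐ k q.asIdeal
  let ρ := Algebra.TensorProduct.map π g
  have hg : Function.Surjective g := Ideal.Quotient.mkₐ_surjective k q.asIdeal
  have hρ : Function.Surjective ρ := tensorProduct_map_surjective hπ hg
  have hginj := PrimeSpectrum.comap_injective_of_surjective g.toRingHom hg
  have hgbot : PrimeSpectrum.comap g.toRingHom ⊥ = q := PrimeSpectrum.ext Ideal.mk_ker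
  have hbq : BoundedTrdeg k (B ⧸ q.asIdeal) := hB.of_surjective g hg
  have hbD := (BoundedTrdeg.of_eTrdeg_ne_top hD).tensor hbq
  obtain ⟨y₂, rfl⟩ : ∃ y₂, PrimeSpectrum.comap ρ.toRingHom y₂ = P₂ := by
    refine exists_comap_map_eq hπ hg P₂ (hl ▸ hPk) ?_
    rw [← hr, comapRight_comap_map]
    exact Ideal.comap_mono bot_le
  have h₂ : heightAddTrdeg k yP = heightAddTrdeg k y₂ := by
    refine fibreConst_includeRight hD hDAF hbq yP y₂ (hginj ?_)
    rwa [comapRight_comap_map, comapRight_comap_map] at hr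
  obtain ⟨y', -, hy'0, h₃⟩ := exists_le_height_comp_add_le
    (strictMono_comap_of_surjective ρ.toRingHom hρ) y₂ (hbD.height_ne_top y₂)
  obtain ⟨hy'l, hy'r⟩ : comapLeft y' = ⊥ ∧ comapRight y' = ⊥ := by
    obtain ⟨y, hy, hyl, hyr⟩ := exists_le_comapLeft_eq_bot y'
    rw [(Order.height_eq_zero.1 hy'0).eq_of_le hy] at hyl hyr
    exact ⟨hyl, hyr⟩
  have hyQr : comapRight yQ = ⊥ := hginj (by
    rw [← comapRight_comap_map π g, hyQ, comapRight_comap_baseMap, hgbot])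
  have h₄ : heightAddTrdeg k yQ = heightAddTrdeg k y' :=
    fibreConst_includeRight hD hDAF hbq yQ y' (hyQr.trans hy'r.symm)
  obtain ⟨Q₂, hQ₂l, hQ₂, h₅⟩ := exists_comap_baseMap_eq_of_comapLeft (ψ := ψ)
    (PrimeSpectrum.comap ρ.toRingHom y') m (by
      rw [comapLeft_comap_map, hy'l]
      exact PrimeSpectrum.ext hker)
  have h₆ : heightAddTrdeg k Q = heightAddTrdeg k Q₂ := by
    refine fibreConst_includeRight hT hTAF hB Q Q₂ ?_
    change q = comapRight Q₂
    rw [← comapRight_comap_baseMap ψ Q₂, hQ₂, comapRight_comap_map, hy'r, hgbot]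
  have h₇ := height_le_height_comap_baseMap hT hTAF hB m hm hψ hM Q₂ hQ₂l
  have hQl : comapLeft Q = m :=
    (PrimeSpectrum.ext (hmax.eq_of_le (PrimeSpectrum.isPrime _).ne_top
      (extendLeft_le_iff.1 hIQ))).symm
  have h₈ : trdegAt k m ≤ trdegAt k Q := hQl ▸ trdegAt_comap_le _ Q
  have h₉ : trdegAt k yQ ≤ trdegAt k Q := by
    rw [← trdegAt_comap_of_surjective ρ hρ yQ, hyQ]
    exact trdegAt_comap_le _ Q
  rw [hQ₂] at h₇
  rw [trdegAt_comap_of_surjective ρ hρ] at h₅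
  simp only [heightAddTrdeg] at h₂ h₄ h₆ ⊢
  rw [trdegAt_comap_of_surjective ρ hρ, trdegAt_comap_of_surjective ρ hρ]
  obtain ⟨a, ha⟩ := ENat.ne_top_iff_exists.1 (hbT.ne_top Q)
  obtain ⟨b, hb⟩ := ENat.ne_top_iff_exists.1 (hbT.height_ne_top Q)
  obtain ⟨a₂, ha₂⟩ := ENat.ne_top_iff_exists.1 (hbT.ne_top Q₂)
  obtain ⟨b₂, hb₂⟩ := ENat.ne_top_iff_exists.1 (hbT.height_ne_top Q₂)
  obtain ⟨c, hc⟩ := ENat.ne_top_iff_exists.1 (hbD.ne_top yP)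
  obtain ⟨d, hd⟩ := ENat.ne_top_iff_exists.1 (hbD.height_ne_top yP)
  obtain ⟨c₁, hc₁⟩ := ENat.ne_top_iff_exists.1 (hbD.ne_top yQ)
  obtain ⟨d₁, hd₁⟩ := ENat.ne_top_iff_exists.1 (hbD.height_ne_top yQ)
  obtain ⟨c₂, hc₂⟩ := ENat.ne_top_iff_exists.1 (hbD.ne_top y₂)
  obtain ⟨d₂, hd₂⟩ := ENat.ne_top_iff_exists.1 (hbD.height_ne_top y₂)
  obtain ⟨c', hc'⟩ := ENat.ne_top_iff_exists.1 (hbD.ne_top y')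
  obtain ⟨n, hn⟩ := ENat.ne_top_iff_exists.1
    (hbA.height_ne_top (PrimeSpectrum.comap ρ.toRingHom yP))
  obtain ⟨n₂, hn₂⟩ := ENat.ne_top_iff_exists.1
    (hbA.height_ne_top (PrimeSpectrum.comap ρ.toRingHom y₂))
  obtain ⟨n', hn'⟩ := ENat.ne_top_iff_exists.1
    (hbA.height_ne_top (PrimeSpectrum.comap ρ.toRingHom y'))
  obtain ⟨l, hl⟩ := ENat.ne_top_iff_exists.1 ((BoundedTrdeg.of_eTrdeg_ne_top hT).ne_top m)
  change Order.height (PrimeSpectrum.comap ρ.toRingHom yP) + _ ≤ _ at h₁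
  rw [← hn, ← hd₁, ← hb, ← hd] at h₁
  rw [← hd, ← hc, ← hd₂, ← hc₂] at h₂
  rw [← hn', ← hd₂, ← hn₂] at h₃
  rw [← hd₁, ← hc₁, hy'0, ← hc'] at h₄
  rw [← ha₂, ← hl, ← hc', le_max_iff] at h₅
  rw [← hb, ← ha, ← hb₂, ← ha₂] at h₆
  rw [← hb₂, ← hn'] at h₇
  rw [← hl, ← ha] at h₈
  rw [← hc₁, ← ha] at h₉
  rw [← hn, ← hc, ← hn₂, ← hc₂]
  norm_cast at h₁ h₂ h₃ h₄ h₅ h₆ h₇ h₈ h₉ ⊢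
  omega

end Pullback

/-- the pullback `A = φ⁻¹(D)` with `T`, `D` AF-domains and `ht M ≤ 2` is a GAF-domain. -/
theorem stmt_15 (k T : Type) [Field k] [CommRing T] [IsDomain T] [Algebra k T]
    (hTfin : eTrdeg k T ≠ ⊤)
    (M : Ideal T) [hM : M.IsMaximal]
    (D : Subalgebra k (T ⧸ M))
    (A : Subalgebra k T) (hA : A = D.comap (Ideal.Quotient.mkₐ k M))
    (hTAF : IsAFDomain k T) (hDAF : IsAFDomain k ↥D)
    (hM2 : idealHt M ≤ 2) :
    IsGAFDomain k ↥A := by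
  subst hA
  let A : Subalgebra k T := D.comap (Ideal.Quotient.mkₐ k M)
  let m : PrimeSpectrum T := ⟨M, hM.isPrime⟩
  have : m.asIdeal.IsMaximal := hM
  let π : A →ₐ[k] D := ((Ideal.Quotient.mkₐ k M).comp A.val).codRestrict D fun a => a.2
  have hπ : Function.Surjective π := fun d => by
    obtain ⟨t, ht⟩ := Ideal.Quotient.mk_surjective d.1
    exact ⟨⟨t, show Ideal.Quotient.mk M t ∈ D from ht ▸ d.2⟩, Subtype.ext ht⟩
  have hker : RingHom.ker π = m.asIdeal.comap A.val.toRingHom := by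
    ext a
    exact Subtype.ext_iff.trans Ideal.Quotient.eq_zero_iff_mem
  have hrange : ∀ x ∈ m.asIdeal, x ∈ A.val.range := fun x hx =>
    ⟨⟨x, show Ideal.Quotient.mk M x ∈ D from
      (Ideal.Quotient.eq_zero_iff_mem.2 hx) ▸ zero_mem D⟩, rfl⟩
  have hinj : Function.Injective A.val := Subtype.val_injective
  refine isGAFDomain_of_heightAddTrdeg_le
    (ne_top_of_le_ne_top hTfin (eTrdeg_le_of_injective A.val hinj)) fun B _ _ hB P Q hl hr => ?_
  exact heightAddTrdeg_le_of_pullback hπ hTfin hTAF.heightAddTrdeg_eq hDAF.heightAddTrdeg_eq hB m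
    hinj hrange hker P Q hl hr
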